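/- Let m ≥ 1 and let π be an irreducible permutation of {1,...,m}. Then for Lebesgue-almost every λ in the positive orthant ℝ_+^m, the following holds for every vector t ∈ ℝ^m with all components positive: if there exist orbits S_j, S_k ∈ Σ(π) such that the real numbers b_{S_j} · t and b_{S_k} · t are linearly independent over the integers (i.e. n₁(b_{S_j}·t) + n₂(b_{S_k}·t) = 0 with n₁, n₂ ∈ ℤ forces n₁ = n₂ = 0), then for every real α ≠ 0 the functional equation f(T_{(λ,π)} x) = exp(2πi α t_j) f(x) for x ∈ I_j^λ (Lebesgue-almost everywhere on [0,|λ|)) admits no measurable solution f : [0,|λ|) → ℂ that is nonzero on a set of positive Lebesgue measure. -/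

import Mathlib

open MeasureTheory Set

noncomputable section

open scoped Classical

/-- Left endpoint of the `j`-th subinterval: `∑_{i<j} λ_i`. -/
def pre {m : ℕ} (lam : Fin m → ℝ) (j : Fin m) : ℝ :=
  ∑ i ∈ Finset.univ.filter (fun i => i < j), lam i

/-- The `j`-th subinterval `I_j^λ = [∑_{i<j} λ_i, ∑_{i≤j} λ_i)`. -/
def block {m : ℕ} (lam : Fin m → ℝ) (j : Fin m) : Set ℝ :=
  Set.Ico (pre lam j) (pre lam j + lam j)

/-- The translation vector `w_j = ∑_{i : π(i) < π(j)} λ_i − ∑_{i<j} λ_i`. -/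
def wvec {m : ℕ} (lam : Fin m → ℝ) (π : Equiv.Perm (Fin m)) (j : Fin m) : ℝ :=
  (∑ i ∈ Finset.univ.filter (fun i => π i < π j), lam i) - pre lam j

/-- The interval exchange transformation `T_{(λ,π)}`: on `I_j^λ` it is `x ↦ x + w_j`
(the subintervals `I_j^λ` are pairwise disjoint, so at most one summand is nonzero). -/
def iet {m : ℕ} (lam : Fin m → ℝ) (π : Equiv.Perm (Fin m)) (x : ℝ) : ℝ :=
  x + ∑ j : Fin m, if x ∈ block lam j then wvec lam π j else 0

/-- The multiplier `φ_{(λ,ν)}(x) = exp(2πi ν_j)` for `x ∈ I_j^λ`. -/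
def phiFn {m : ℕ} (lam : Fin m → ℝ) (nu : Fin m → ℝ) (x : ℝ) : ℂ :=
  ∏ j : Fin m,
    if x ∈ block lam j then Complex.exp (2 * Real.pi * Complex.I * (nu j : ℂ)) else 1

/-- `π` is irreducible: `π({1,…,k}) = {1,…,k}` (for `1 ≤ k ≤ m`) only for `k = m`. -/
def PermIrreducible {m : ℕ} (π : Equiv.Perm (Fin m)) : Prop :=
  ∀ k : ℕ, 1 ≤ k → k ≤ m →
    (Finset.univ.filter (fun i : Fin m => (i : ℕ) < k)).image π =
      Finset.univ.filter (fun i : Fin m => (i : ℕ) < k) →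
    k = m

/-- `π` extended to `{0,1,…,m+1}` (as a map of `ℕ`) by `π(0) = 0`, `π(m+1) = m+1`. -/
def piExt {m : ℕ} (π : Equiv.Perm (Fin m)) (i : ℕ) : ℕ :=
  if h : 1 ≤ i ∧ i ≤ m then (π ⟨i - 1, by omega⟩ : ℕ) + 1 else i

/-- The corresponding extension of `π⁻¹`. -/
def piExtInv {m : ℕ} (π : Equiv.Perm (Fin m)) (i : ℕ) : ℕ :=
  if h : 1 ≤ i ∧ i ≤ m then (π.symm ⟨i - 1, by omega⟩ : ℕ) + 1 else i

/-- The map `σ_π(i) = π⁻¹(π(i)+1) − 1`, for `0 ≤ i ≤ m`. -/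
def sigmaPi {m : ℕ} (π : Equiv.Perm (Fin m)) (i : ℕ) : ℕ :=
  piExtInv π (piExt π i + 1) - 1

/-- The orbit of `i ∈ {0,…,m}` under iteration of `σ_π`. -/
def orbitOf {m : ℕ} (π : Equiv.Perm (Fin m)) (i : ℕ) : Finset ℕ :=
  (Finset.Iic m).filter (fun j => ∃ n : ℕ, (sigmaPi π)^[n] i = j)

/-- `Σ(π)`: the set of orbits of `σ_π` on `{0,1,…,m}`. -/
def orbitsOf {m : ℕ} (π : Equiv.Perm (Fin m)) : Finset (Finset ℕ) :=
  (Finset.Iic m).image (orbitOf π)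

/-- The vector `b_S ∈ ℤ^m`, `(b_S)_i = χ_S(i−1) − χ_S(i)` for `1 ≤ i ≤ m`
(the index `i : Fin m` encodes the 1-based index `i+1`). -/
def bvec {m : ℕ} (S : Finset ℕ) (i : Fin m) : ℤ :=
  (if (i : ℕ) ∈ S then 1 else 0) - (if (i : ℕ) + 1 ∈ S then 1 else 0)

namespace IET

variable {m : ℕ}

/-- The left endpoint of the `a`-th interval when letters are placed in the order `p`,
as a linear form in the length vector. -/
def off (p : Equiv.Perm (Fin m)) (a : Fin m) : (Fin m → ℝ) →ₗ[ℝ] ℝ :=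
  ∑ b ∈ Finset.univ.filter (fun b => p b < p a), LinearMap.proj b

lemma off_apply (p : Equiv.Perm (Fin m)) (a : Fin m) (lam : Fin m → ℝ) :
    off p a lam = ∑ b ∈ Finset.univ.filter (fun b => p b < p a), lam b := by
  simp [off, LinearMap.sum_apply]

lemma off_single (p : Equiv.Perm (Fin m)) (a b : Fin m) :
    off p a (Pi.single b 1) = if p b < p a then 1 else 0 := by
  rw [off_apply]
  simp [Pi.single_apply, Finset.sum_ite_eq']

/-- The translation of the letter `a`, as a linear form in the length vector. -/
def wv (p q : Equiv.Perm (Fin m)) (a : Fin m) : (Fin m → ℝ) →ₗ[ℝ] ℝ := off q a - off p a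

/-- The interval of the letter `a` in the order `p`. -/
def blk (p : Equiv.Perm (Fin m)) (lam : Fin m → ℝ) (a : Fin m) : Set ℝ :=
  Ico (off p a lam) (off p a lam + lam a)

/-- The exchange from the order `p` to the order `q`. -/
def trans (p q : Equiv.Perm (Fin m)) (lam : Fin m → ℝ) (x : ℝ) : ℝ :=
  x + ∑ a : Fin m, if x ∈ blk p lam a then wv p q a lam else 0

section basic

variable {p q : Equiv.Perm (Fin m)} {lam : Fin m → ℝ}

lemma off_nonneg (hl : ∀ a, 0 ≤ lam a) (a : Fin m) : 0 ≤ off p a lam := by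
  rw [off_apply]; exact Finset.sum_nonneg fun b _ => hl b

lemma off_add_le_off (hl : ∀ a, 0 ≤ lam a) {a b : Fin m} (h : p a < p b) :
    off p a lam + lam a ≤ off p b lam := by
  rw [off_apply, off_apply, add_comm, ← Finset.sum_insert (a := a) (by simp)]
  refine Finset.sum_le_sum_of_subset_of_nonneg ?_ fun c _ _ => hl c
  intro c hc
  simp only [Finset.mem_insert, Finset.mem_filter, Finset.mem_univ, true_and] at hc ⊢
  rcases hc with rfl | hc
  · exact h
  · exact hc.trans h

lemma off_add_eq_off {a b : Fin m} (h : (p b : ℕ) = p a + 1) :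
    off p b lam = off p a lam + lam a := by
  rw [off_apply, off_apply, add_comm, ← Finset.sum_insert (a := a) (by simp)]
  congr 1
  ext c
  simp only [Finset.mem_insert, Finset.mem_filter, Finset.mem_univ, true_and, Fin.lt_def]
  constructor
  · intro hc
    rcases Nat.lt_or_ge (p c : ℕ) (p a) with h1 | h1
    · exact Or.inr h1
    · left; exact p.injective (Fin.ext (by omega))
  · rintro (rfl | hc) <;> omega

lemma off_add_eq_sum {a : Fin m} (h : (p a : ℕ) + 1 = m) :
    off p a lam + lam a = ∑ b, lam b := by
  rw [off_apply, add_comm, ← Finset.sum_insert (a := a) (by simp)]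
  congr 1
  ext c
  simp only [Finset.mem_insert, Finset.mem_filter, Finset.mem_univ, true_and, Fin.lt_def,
    iff_true]
  rcases Nat.lt_or_ge (p c : ℕ) (p a) with h1 | h1
  · exact Or.inr h1
  · left; exact p.injective (Fin.ext (by have := (p c).2; omega))

lemma off_eq_zero {a : Fin m} (h : (p a : ℕ) = 0) : off p a lam = 0 := by
  rw [off_apply, Finset.filter_false_of_mem, Finset.sum_empty]
  intro b _
  simp [Fin.lt_def, h]

lemma off_add_le_sum (hl : ∀ a, 0 ≤ lam a) (a : Fin m) :
    off p a lam + lam a ≤ ∑ b, lam b := by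
  rw [off_apply, add_comm, ← Finset.sum_insert (a := a) (by simp)]
  exact Finset.sum_le_sum_of_subset_of_nonneg (Finset.subset_univ _) fun c _ _ => hl c

lemma blk_subset (hl : ∀ a, 0 ≤ lam a) (a : Fin m) :
    blk p lam a ⊆ Ico 0 (∑ b, lam b) := by
  intro x hx
  exact ⟨(off_nonneg hl a).trans hx.1, hx.2.trans_le (off_add_le_sum hl a)⟩

lemma lt_of_mem_blk (hl : ∀ a, 0 ≤ lam a) {a b : Fin m} {x y : ℝ} (h : p a < p b)
    (hx : x ∈ blk p lam a) (hy : y ∈ blk p lam b) : x < y :=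
  hx.2.trans_le ((off_add_le_off hl h).trans hy.1)

lemma blk_unique (hl : ∀ a, 0 ≤ lam a) {a b : Fin m} {x : ℝ}
    (hx : x ∈ blk p lam a) (hy : x ∈ blk p lam b) : a = b := by
  by_contra hab
  rcases lt_or_gt_of_ne (fun h => hab (p.injective h)) with h | h
  · exact lt_irrefl _ (lt_of_mem_blk hl h hx hy)
  · exact lt_irrefl _ (lt_of_mem_blk hl h hy hx)

lemma lt_off_iff (hl : ∀ a, 0 ≤ lam a) {a b : Fin m} {x : ℝ} (hx : x ∈ blk p lam a) :
    x < off p b lam ↔ p a < p b := by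
  constructor
  · intro h
    by_contra hab
    rcases (not_lt.1 hab).lt_or_eq with h1 | h1
    · have := off_add_le_off hl h1
      have := hx.1
      have := hl b
      linarith
    · have := p.injective h1
      subst this
      exact absurd hx.1 (not_le.2 h)
  · intro h
    exact hx.2.trans_le (off_add_le_off hl h)

lemma exists_mem_blk {x : ℝ} (hx : x ∈ Ico 0 (∑ b, lam b)) : ∃ a, x ∈ blk p lam a := by
  have hm : 0 < m := by
    rcases Nat.eq_zero_or_pos m with rfl | h
    · simp at hx
    · exact h
  obtain ⟨a, ha, hmax⟩ := Finset.exists_max_image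
    (Finset.univ.filter fun a => off p a lam ≤ x) (fun a => p a)
    ⟨p.symm ⟨0, hm⟩, by simpa [off_eq_zero] using hx.1⟩
  simp only [Finset.mem_filter, Finset.mem_univ, true_and] at ha hmax
  refine ⟨a, ha, ?_⟩
  by_contra hcon
  rw [not_lt] at hcon
  by_cases hlast : (p a : ℕ) + 1 = m
  · rw [off_add_eq_sum hlast] at hcon
    exact absurd hx.2 (not_lt.2 hcon)
  · have hlt : (p a : ℕ) + 1 < m := by have := (p a).2; omega
    have h1 : off p (p.symm ⟨p a + 1, hlt⟩) lam = off p a lam + lam a :=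
      off_add_eq_off (by simp)
    have := hmax (p.symm ⟨p a + 1, hlt⟩) (by rw [h1]; exact hcon)
    simp [Fin.le_def] at this

lemma trans_of_mem (hl : ∀ a, 0 ≤ lam a) {a : Fin m} {x : ℝ} (hx : x ∈ blk p lam a) :
    trans p q lam x = x + wv p q a lam := by
  rw [trans, Finset.sum_eq_single a]
  · rw [if_pos hx]
  · intro b _ hb
    rw [if_neg]
    exact fun h => hb (blk_unique hl h hx)
  · simp

lemma trans_mem_blk (hl : ∀ a, 0 ≤ lam a) {a : Fin m} {x : ℝ} (hx : x ∈ blk p lam a) :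
    trans p q lam x ∈ blk q lam a := by
  rw [trans_of_mem hl hx]
  simp only [wv, blk, mem_Ico, LinearMap.sub_apply] at hx ⊢
  constructor <;> linarith [hx.1, hx.2]

lemma trans_mem (hl : ∀ a, 0 ≤ lam a) {x : ℝ} (hx : x ∈ Ico 0 (∑ b, lam b)) :
    trans p q lam x ∈ Ico 0 (∑ b, lam b) := by
  obtain ⟨a, ha⟩ := exists_mem_blk (p := p) hx
  exact blk_subset hl a (trans_mem_blk hl ha)

lemma iterate_trans_mem (hl : ∀ a, 0 ≤ lam a) {x : ℝ} (hx : x ∈ Ico 0 (∑ b, lam b)) (n : ℕ) :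
    (trans p q lam)^[n] x ∈ Ico 0 (∑ b, lam b) := by
  induction n with
  | zero => exact hx
  | succ n ih => rw [Function.iterate_succ_apply']; exact trans_mem hl ih

lemma trans_trans (hl : ∀ a, 0 ≤ lam a) {x : ℝ} (hx : x ∈ Ico 0 (∑ b, lam b)) :
    trans q p lam (trans p q lam x) = x := by
  obtain ⟨a, ha⟩ := exists_mem_blk (p := p) hx
  rw [trans_of_mem hl (trans_mem_blk hl ha), trans_of_mem hl ha]
  simp only [wv, LinearMap.sub_apply]
  ring

lemma trans_injOn (hl : ∀ a, 0 ≤ lam a) : InjOn (trans p q lam) (Ico 0 (∑ b, lam b)) := by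
  intro x hx y hy h
  rw [← trans_trans (p := p) (q := q) hl hx, h, trans_trans hl hy]

lemma off_mem (hl : ∀ a, 0 < lam a) (a : Fin m) : off p a lam ∈ Ico 0 (∑ b, lam b) :=
  blk_subset (fun a => (hl a).le) a ⟨le_rfl, by linarith [hl a]⟩

lemma trans_off (hl : ∀ a, 0 < lam a) (a : Fin m) :
    trans p q lam (off p a lam) = off q a lam := by
  rw [trans_of_mem (a := a) (fun a => (hl a).le) ⟨le_rfl, by linarith [hl a]⟩]
  simp [wv]

/-- How the order of two points changes under the exchange. -/
lemma ite_trans_lt (hl : ∀ a, 0 ≤ lam a) {a b : Fin m} {x z : ℝ} (hx : x ∈ blk p lam b)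
    (hz : z ∈ blk p lam a) :
    ((if trans p q lam x < trans p q lam z then 1 else 0 : ℝ)) =
      (if x < z then 1 else 0) + wv p q a (Pi.single b 1) := by
  rw [wv, LinearMap.sub_apply, off_single, off_single]
  by_cases hab : b = a
  · subst hab
    rw [trans_of_mem hl hx, trans_of_mem hl hz]
    simp
  · have key : ∀ (r : Equiv.Perm (Fin m)) {y w : ℝ}, y ∈ blk r lam b → w ∈ blk r lam a →
        (y < w ↔ r b < r a) := by
      intro r y w hy hw
      constructor
      · intro h
        by_contra hc
        rcases (not_lt.1 hc).lt_or_eq with h1 | h1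
        · exact lt_asymm h (lt_of_mem_blk hl h1 hw hy)
        · exact hab (r.injective h1.symm)
      · exact fun h => lt_of_mem_blk hl h hy hw
    simp only [key p hx hz, key q (trans_mem_blk hl hx) (trans_mem_blk hl hz)]
    ring

lemma measurable_trans : Measurable (trans p q lam) := by
  unfold trans
  refine measurable_id.add (Finset.measurable_sum _ fun a _ => ?_)
  exact Measurable.ite measurableSet_Ico measurable_const measurable_const

end basic

section preserving

variable {p q : Equiv.Perm (Fin m)} {lam : Fin m → ℝ}

lemma measurableSet_blk {a : Fin m} : MeasurableSet (blk p lam a) := measurableSet_Ico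

lemma iUnion_blk (hl : ∀ a, 0 ≤ lam a) : ⋃ a, blk p lam a = Ico 0 (∑ b, lam b) := by
  refine Subset.antisymm (iUnion_subset fun a => blk_subset hl a) fun x hx => ?_
  exact mem_iUnion.2 (exists_mem_blk hx)

lemma volume_inter_eq_sum (p : Equiv.Perm (Fin m)) (hl : ∀ a, 0 ≤ lam a) {A : Set ℝ}
    (hA : MeasurableSet A) :
    volume (A ∩ Ico 0 (∑ b, lam b)) = ∑ a, volume (A ∩ blk p lam a) := by
  rw [← iUnion_blk (p := p) hl, ← Measure.restrict_apply hA,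
    Measure.restrict_iUnion_apply _ (fun _ => measurableSet_blk) hA, tsum_fintype]
  · exact Finset.sum_congr rfl fun a _ => Measure.restrict_apply hA
  intro a b hab
  exact Set.disjoint_left.2 fun x hx hy => hab (blk_unique hl hx hy)

/-- An interval exchange preserves Lebesgue measure. -/
lemma measurePreserving_trans (hl : ∀ a, 0 ≤ lam a) :
    MeasurePreserving (trans p q lam) (volume.restrict (Ico 0 (∑ b, lam b)))
      (volume.restrict (Ico 0 (∑ b, lam b))) := by
  refine ⟨measurable_trans, ?_⟩
  ext A hA
  rw [Measure.map_apply measurable_trans hA, Measure.restrict_apply (measurable_trans hA),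
    Measure.restrict_apply hA, volume_inter_eq_sum p hl (measurable_trans hA),
    volume_inter_eq_sum q hl hA]
  refine Finset.sum_congr rfl fun a _ => ?_
  have : trans p q lam ⁻¹' A ∩ blk p lam a =
      (fun x => x + wv p q a lam) ⁻¹' (A ∩ blk q lam a) := by
    ext x
    simp only [mem_inter_iff, mem_preimage]
    constructor
    · rintro ⟨h1, h2⟩
      have := trans_mem_blk (q := q) hl h2
      rw [trans_of_mem hl h2] at h1 this
      exact ⟨h1, this⟩
    · rintro ⟨h1, h2⟩
      have h3 : x ∈ blk p lam a := by
        simp only [wv, blk, mem_Ico, LinearMap.sub_apply] at h2 ⊢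
        constructor <;> linarith [h2.1, h2.2]
      exact ⟨by rw [trans_of_mem hl h3]; exact h1, h3⟩
  rw [this, measure_preimage_add_right]

/-- Recurrence for a nondegenerate interval. -/
lemma exists_return (hl : ∀ a, 0 ≤ lam a) {x y : ℝ} (hx : 0 ≤ x) (hxy : x < y)
    (hy : y ≤ ∑ b, lam b) :
    ∃ z ∈ Ico x y, ∃ k, k ≠ 0 ∧ (trans p q lam)^[k] z ∈ Ico x y := by
  have hfin : IsFiniteMeasure (volume.restrict (Ico 0 (∑ b, lam b))) :=
    ⟨by simp⟩
  have hsub : Ico x y ⊆ Ico 0 (∑ b, lam b) := Ico_subset_Ico hx hy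
  refine (measurePreserving_trans (p := p) (q := q) hl).exists_mem_iterate_mem
    measurableSet_Ico.nullMeasurableSet ?_
  rw [Measure.restrict_apply measurableSet_Ico, inter_eq_left.2 hsub]
  simp [hxy]

end preserving

section cyclic

variable {p q : Equiv.Perm (Fin m)} {lam : Fin m → ℝ}

/-- The index of the cell of `x` in the partition of the line by the points of `D`. -/
def cell (D : Finset ℝ) (x : ℝ) : ℕ := (D.filter (· ≤ x)).card

lemma cell_lt_cell_iff {D : Finset ℝ} {x d : ℝ} (hd : d ∈ D) :
    cell D x < cell D d ↔ x < d := by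
  constructor
  · intro h
    by_contra hc
    refine absurd h (not_lt.2 (Finset.card_le_card fun e he => ?_))
    rw [Finset.mem_filter] at he ⊢
    exact ⟨he.1, he.2.trans (not_lt.1 hc)⟩
  · intro h
    refine Finset.card_lt_card (Finset.ssubset_iff_of_subset ?_ |>.2 ⟨d, ?_, ?_⟩)
    · intro e he
      rw [Finset.mem_filter] at he ⊢
      exact ⟨he.1, he.2.trans h.le⟩
    · simpa using hd
    · simp [h]

/-- Shortening a closed walk until it visits every vertex at most once. -/
lemma exists_injOn_closed_walk {X : Type*} (P : X → Prop) (next cur : X → ℕ) (v : ℕ)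
    (h : ∃ k, 0 < k ∧ ∃ y : ℕ → X, (∀ t < k, P (y t) ∧ next (y t) = cur (y (t + 1))) ∧
      cur (y 0) = v ∧ cur (y k) = v) :
    ∃ k, 0 < k ∧ ∃ y : ℕ → X, (∀ t < k, P (y t) ∧ next (y t) = cur (y (t + 1))) ∧
      cur (y 0) = v ∧ cur (y k) = v ∧ InjOn (fun t => cur (y t)) (Finset.range k) := by
  obtain ⟨hk, y, hy, h0, h1⟩ := Nat.find_spec h
  refine ⟨Nat.find h, hk, y, hy, h0, h1, ?_⟩
  have key : ∀ i j, i < j → j < Nat.find h → cur (y i) ≠ cur (y j) := by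
    intro i j hij hj he
    refine Nat.find_min h (m := Nat.find h - (j - i)) (by omega)
      ⟨by omega, fun t => if t < i then y t else y (t + (j - i)), ?_, ?_, ?_⟩
    · intro t ht
      by_cases h2 : t + 1 < i
      · simp only [if_pos h2, if_pos (show t < i by omega)]
        exact hy t (by omega)
      · by_cases h3 : t < i
        · have h4 : t + 1 = i := by omega
          simp only [if_pos h3, if_neg h2]
          have h5 : t + 1 + (j - i) = j := by omega
          rw [h5, ← he, ← h4]
          exact hy t (by omega)
        · simp only [if_neg h3, if_neg h2]
          have := hy (t + (j - i)) (by omega)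
          rwa [show t + 1 + (j - i) = t + (j - i) + 1 by omega]
    · by_cases h2 : 0 < i
      · simpa only [if_pos h2] using h0
      · have : i = 0 := by omega
        subst this
        simpa [← he] using h0
    · have h2 : ¬ (Nat.find h - (j - i) < i) := by omega
      simp only [if_neg h2]
      rwa [Nat.sub_add_cancel (by omega)]
  intro i hi j hj hij
  simp only [Finset.coe_range, mem_Iio] at hi hj
  by_contra hne
  rcases lt_or_gt_of_ne hne with h2 | h2
  · exact key i j h2 hj hij
  · exact key j i h2 hi hij.symm

/-- A short pseudo-orbit that is balanced with respect to all the points of `D` and starts in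
the cell of a given point. -/
lemma exists_balanced (hl : ∀ a, 0 ≤ lam a) (D : Finset ℝ) {d₀ : ℝ} (hd : d₀ ∈ D)
    (hd₀ : d₀ ∈ Ico 0 (∑ b, lam b)) :
    ∃ (k : ℕ) (y : ℕ → ℝ), 0 < k ∧ k ≤ D.card + 1 ∧ (∀ t < k, y t ∈ Ico 0 (∑ b, lam b)) ∧
      (∀ d ∈ D, (∑ t ∈ Finset.range k, if trans p q lam (y t) < d then (1 : ℝ) else 0) =
        ∑ t ∈ Finset.range k, if y t < d then 1 else 0) ∧
      d₀ ≤ y 0 ∧ ∀ d ∈ D, d₀ < d → y 0 < d := by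
  obtain ⟨k, hk, y, hy, h0, h1, hinj⟩ := exists_injOn_closed_walk
    (fun x : ℝ => x ∈ Ico 0 (∑ b, lam b)) (fun x => cell D (trans p q lam x)) (cell D)
    (cell D d₀) (by
      set F := insert (∑ b, lam b) (D.filter (d₀ < ·)) with hF
      have hFne : F.Nonempty := Finset.insert_nonempty _ _
      have hlt : d₀ < F.min' hFne := by
        rw [Finset.lt_min'_iff]
        intro e he
        rw [hF, Finset.mem_insert, Finset.mem_filter] at he
        rcases he with rfl | he
        · exact hd₀.2
        · exact he.2
      have hcell : ∀ z ∈ Ico d₀ (F.min' hFne), cell D z = cell D d₀ := by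
        intro z hz
        unfold cell
        congr 1
        ext e
        simp only [Finset.mem_filter, and_congr_right_iff]
        intro he
        constructor
        · intro h
          by_contra hc
          have : F.min' hFne ≤ e := Finset.min'_le _ _ (by simp [hF, he, not_le.1 hc])
          linarith [hz.2]
        · exact fun h => h.trans hz.1
      obtain ⟨z, hz, k, hk, hzk⟩ := exists_return (p := p) (q := q) hl hd₀.1 hlt
        (Finset.min'_le _ _ (by simp [hF]))
      refine ⟨k, Nat.pos_of_ne_zero hk, fun t => (trans p q lam)^[t] z, ?_, hcell z hz,
        hcell _ hzk⟩
      intro t _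
      refine ⟨iterate_trans_mem hl ?_ t, by simp only [Function.iterate_succ_apply']⟩
      exact ⟨hd₀.1.trans hz.1, hz.2.trans_le (Finset.min'_le _ _ (by simp [hF]))⟩)
  refine ⟨k, y, hk, ?_, fun t ht => (hy t ht).1, ?_, ?_, ?_⟩
  · have := Finset.card_le_card_of_injOn (s := Finset.range k)
      (t := Finset.range (D.card + 1)) (fun t => cell D (y t))
      (fun t _ => Finset.mem_coe.2 <| Finset.mem_range.2
        (Nat.lt_succ_of_le (Finset.card_filter_le D (· ≤ y t)))) hinj
    simpa using this
  · intro d hdD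
    have e1 : ∀ t ∈ Finset.range k, (if trans p q lam (y t) < d then (1 : ℝ) else 0) =
        if cell D (y (t + 1)) < cell D d then 1 else 0 := by
      intro t ht
      rw [← (hy t (Finset.mem_range.1 ht)).2]
      simp only [cell_lt_cell_iff hdD]
    have e2 : ∀ t ∈ Finset.range k, (if y t < d then (1 : ℝ) else 0) =
        if cell D (y t) < cell D d then 1 else 0 := by
      intro t _
      simp only [cell_lt_cell_iff hdD]
    rw [Finset.sum_congr rfl e1, Finset.sum_congr rfl e2]
    have h2 := Finset.sum_range_succ (fun t => if cell D (y t) < cell D d then (1 : ℝ) else 0) k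
    rw [Finset.sum_range_succ'] at h2
    simp only [h0, h1] at h2
    linarith
  · exact not_lt.1 fun h => absurd ((cell_lt_cell_iff hd).2 h) (by rw [h0]; exact lt_irrefl _)
  · intro d hdD h
    rw [← cell_lt_cell_iff hdD, h0]
    exact (cell_lt_cell_iff hdD).2 h

end cyclic

section labels

variable {p q : Equiv.Perm (Fin m)} {lam : Fin m → ℝ} {n : ℕ}

/-- Labels for the discontinuities of `trans p q` and for the first `n` points of the forward
orbits of the discontinuities of `trans q p`. -/
abbrev Lab (q : Equiv.Perm (Fin m)) (n : ℕ) : Type :=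
  Fin m ⊕ ({b : Fin m // (q b : ℕ) ≠ 0} × Fin n)

/-- The point carrying a label. -/
def pt (p q : Equiv.Perm (Fin m)) (lam : Fin m → ℝ) : Lab q n → ℝ
  | .inl a => off p a lam
  | .inr (b, l) => (trans p q lam)^[l] (off q b lam)

/-- The point carrying a label, as a linear form, for prescribed itineraries. -/
def form (p q : Equiv.Perm (Fin m)) (w : {b : Fin m // (q b : ℕ) ≠ 0} → Fin n → Fin m) :
    Lab q n → ((Fin m → ℝ) →ₗ[ℝ] ℝ)
  | .inl a => off p a
  | .inr (b, l) => off q b + ∑ i ∈ Finset.univ.filter (· < l), wv p q (w b i)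

lemma form_zero (w : {b : Fin m // (q b : ℕ) ≠ 0} → Fin n → Fin m)
    (b : {b : Fin m // (q b : ℕ) ≠ 0}) (h : 0 < n) :
    form p q w (.inr (b, ⟨0, h⟩)) = off q b := by
  have : (Finset.univ.filter (· < (⟨0, h⟩ : Fin n))) = ∅ :=
    Finset.filter_false_of_mem fun i _ => by simp [Fin.lt_def]
  simp [form, this]

lemma form_succ (w : {b : Fin m // (q b : ℕ) ≠ 0} → Fin n → Fin m)
    (b : {b : Fin m // (q b : ℕ) ≠ 0}) (l : ℕ) (h : l + 1 < n) :
    form p q w (.inr (b, ⟨l + 1, h⟩)) =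
      form p q w (.inr (b, ⟨l, by omega⟩)) + wv p q (w b ⟨l, by omega⟩) := by
  have : (Finset.univ.filter (· < (⟨l + 1, h⟩ : Fin n))) =
      insert ⟨l, by omega⟩ (Finset.univ.filter (· < (⟨l, by omega⟩ : Fin n))) := by
    ext i
    simp only [Finset.mem_filter, Finset.mem_univ, true_and, Finset.mem_insert, Fin.lt_def,
      Fin.ext_iff]
    omega
  simp only [form, this]
  rw [Finset.sum_insert (by simp)]
  abel

lemma pt_succ (b : {b : Fin m // (q b : ℕ) ≠ 0}) (l : ℕ) (h : l + 1 < n) :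
    pt p q lam (.inr (b, (⟨l + 1, h⟩ : Fin n))) =
      trans p q lam (pt p q lam (.inr (b, (⟨l, by omega⟩ : Fin n)))) := by
  simp [pt, Function.iterate_succ_apply']

lemma form_eq_pt (hl : ∀ a, 0 ≤ lam a) {w : {b : Fin m // (q b : ℕ) ≠ 0} → Fin n → Fin m}
    (hw : ∀ b l, form p q w (.inr (b, l)) lam ∈ blk p lam (w b l) ∨
      pt p q lam (.inr (b, l)) ∈ blk p lam (w b l)) (L : Lab q n) :
    form p q w L lam = pt p q lam L := by
  rcases L with a | ⟨b, l, hl'⟩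
  · rfl
  · induction l with
    | zero => rw [form_zero]; rfl
    | succ l ih =>
      have h1 := ih (by omega)
      have h2 := hw b ⟨l, by omega⟩
      rw [h1, or_self] at h2
      rw [form_succ, pt_succ, trans_of_mem hl h2, LinearMap.add_apply, h1]

lemma pt_mem (hl : ∀ a, 0 < lam a) (L : Lab q n) : pt p q lam L ∈ Ico 0 (∑ b, lam b) := by
  rcases L with a | ⟨b, l⟩
  · exact off_mem hl a
  · exact iterate_trans_mem (fun a => (hl a).le) (off_mem hl _) _

lemma sum_single_letters (k : ℕ) (s : ℕ → Fin m) (g : (Fin m → ℝ) →ₗ[ℝ] ℝ) :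
    g (∑ t ∈ Finset.range k, Pi.single (s t) 1) =
      ∑ t ∈ Finset.range k, g (Pi.single (s t) 1) := map_sum _ _ _

/-- An integral weight that respects the order of the labelled points, and separates a given
label from the larger ones. -/
lemma exists_weight (hl : ∀ a, 0 < lam a) {w : {b : Fin m // (q b : ℕ) ≠ 0} → Fin n → Fin m}
    (hw : ∀ b l, pt p q lam (.inr (b, l)) ∈ blk p lam (w b l)) (L₀ : Lab q n) :
    ∃ u : Fin m → ℝ, (∀ L, ∃ z : ℤ, form p q w L u = z) ∧ (∃ z : ℤ, ∑ b, u b = z) ∧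
      ∑ b, u b ≤ Fintype.card (Lab q n) + 1 ∧
      (∀ L L', pt p q lam L ≤ pt p q lam L' → form p q w L u ≤ form p q w L' u) ∧
      (∀ L, form p q w L u ≤ ∑ b, u b) ∧
      (∀ L', pt p q lam L₀ < pt p q lam L' → form p q w L₀ u + 1 ≤ form p q w L' u) ∧
      form p q w L₀ u + 1 ≤ ∑ b, u b := by
  have hl0 : ∀ a, 0 ≤ lam a := fun a => (hl a).le
  set D : Finset ℝ := Finset.univ.image (pt p q lam : Lab q n → ℝ) with hD
  have hptD : ∀ L : Lab q n, pt p q lam L ∈ D := fun L =>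
    Finset.mem_image_of_mem _ (Finset.mem_univ L)
  obtain ⟨k, y, hk, hkD, hy, hbal, hy0, hy1⟩ :=
    exists_balanced (p := p) (q := q) hl0 D (hptD L₀) (pt_mem hl L₀)
  have hs : ∀ t, ∃ a, t < k → y t ∈ blk p lam a := by
    intro t
    by_cases ht : t < k
    · obtain ⟨a, ha⟩ := exists_mem_blk (p := p) (hy t ht)
      exact ⟨a, fun _ => ha⟩
    · obtain ⟨a, ha⟩ := exists_mem_blk (p := p) (hy 0 hk)
      exact ⟨a, fun h => absurd h ht⟩
  choose s hs using hs
  set u : Fin m → ℝ := ∑ t ∈ Finset.range k, Pi.single (s t) 1 with hu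
  set c : ℝ → ℝ := fun z => ∑ t ∈ Finset.range k, if y t < z then (1 : ℝ) else 0 with hc
  have hsum : ∑ b, u b = k := by
    have : ∀ b, u b = ∑ t ∈ Finset.range k, (Pi.single (s t) 1 : Fin m → ℝ) b := fun b => by
      simp [hu]
    simp only [this]
    rw [Finset.sum_comm]
    simp
  have hform : ∀ L, form p q w L u = c (pt p q lam L) := by
    rintro (a | ⟨b, l, hl'⟩)
    · simp only [form, pt, hc, hu, sum_single_letters]
      refine Finset.sum_congr rfl fun t ht => ?_
      rw [off_single]
      simp only [lt_off_iff hl0 (hs t (Finset.mem_range.1 ht))]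
    · induction l with
      | zero =>
        rw [form_zero, hu, sum_single_letters, hc]
        beta_reduce
        rw [← hbal _ (hptD _)]
        refine Finset.sum_congr rfl fun t ht => ?_
        rw [off_single]
        simp only [pt, Function.iterate_zero, id_eq,
          lt_off_iff hl0 (trans_mem_blk (q := q) hl0 (hs t (Finset.mem_range.1 ht)))]
      | succ l ih =>
        have hb := hw b ⟨l, by omega⟩
        rw [form_succ, LinearMap.add_apply, ih (by omega)]
        simp only [hc]
        rw [← hbal _ (hptD (.inr (b, ⟨l + 1, hl'⟩))), pt_succ, hu, sum_single_letters,
          ← Finset.sum_add_distrib]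
        refine Finset.sum_congr rfl fun t ht => ?_
        rw [ite_trans_lt hl0 (hs t (Finset.mem_range.1 ht)) hb]
  have hind : ∀ {z z' : ℝ}, z ≤ z' → ∀ t, (if y t < z then (1 : ℝ) else 0) ≤
      if y t < z' then 1 else 0 := by
    intro z z' h t
    split_ifs with h1 h2
    · exact le_rfl
    · exact absurd (h1.trans_le h) h2
    · exact zero_le_one
    · exact le_rfl
  have hmono : Monotone c := fun z z' h => Finset.sum_le_sum fun t _ => hind h t
  have hck : ∀ z, c z ≤ k := by
    intro z
    calc c z ≤ ∑ t ∈ Finset.range k, (1 : ℝ) := Finset.sum_le_sum fun t _ => by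
          split_ifs <;> norm_num
      _ = k := by simp
  have hstrict : ∀ z, pt p q lam L₀ < z → y 0 < z → c (pt p q lam L₀) + 1 ≤ c z := by
    intro z hz h0
    simp only [hc]
    rw [← Finset.add_sum_erase _ _ (Finset.mem_range.2 hk),
      ← Finset.add_sum_erase _ _ (Finset.mem_range.2 hk), if_neg (not_lt.2 hy0), if_pos h0]
    have := Finset.sum_le_sum (s := (Finset.range k).erase 0) fun t _ => hind hz.le t
    linarith
  refine ⟨u, fun L => ?_, ⟨k, by rw [hsum]; simp⟩, ?_, ?_, ?_, ?_, ?_⟩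
  · refine ⟨∑ t ∈ Finset.range k, if y t < pt p q lam L then 1 else 0, ?_⟩
    rw [hform]
    push_cast
    rfl
  · rw [hsum]
    have : D.card ≤ Fintype.card (Lab q n) := Finset.card_image_le
    exact_mod_cast hkD.trans (by omega)
  · intro L L' h
    rw [hform, hform]
    exact hmono h
  · intro L
    rw [hform, hsum]
    exact hck _
  · intro L' h
    rw [hform, hform]
    exact hstrict _ h (hy1 _ (hptD _) h)
  · rw [hform, hsum]
    have h1 := hstrict (∑ b, lam b) (pt_mem hl L₀).2 (hy 0 hk).2
    linarith [hck (∑ b, lam b)]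

end labels

section weight

variable {p q : Equiv.Perm (Fin m)} {lam : Fin m → ℝ} {n : ℕ}

/-- From a finite family one can select a sum of at most `m` members on which every linear form
that is integral and nonnegative on the family, and not identically zero on it, is at least
one. -/
lemma exists_sum_spanning {ι : Type*} [Finite ι] (U : ι → Fin m → ℝ) :
    ∃ B : Finset (Fin m → ℝ), B.card ≤ m ∧ (∀ v ∈ B, ∃ i, U i = v) ∧
      ∀ g : (Fin m → ℝ) →ₗ[ℝ] ℝ, (∀ i, ∃ z : ℤ, g (U i) = z) → (∀ i, 0 ≤ g (U i)) →
        (∃ i, g (U i) ≠ 0) → 1 ≤ g (∑ v ∈ B, v) := by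
  obtain ⟨b, hb, hspan, hli⟩ := exists_linearIndependent ℝ (range U)
  have hfin : b.Finite := (finite_range U).subset hb
  have := hfin.fintype
  refine ⟨hfin.toFinset, ?_, fun v hv => hb (hfin.mem_toFinset.1 hv), ?_⟩
  · have := hli.fintype_card_le_finrank
    rwa [Module.finrank_fin_fun, ← Set.toFinset_card, ← hfin.toFinset_eq_toFinset] at this
  · intro g hz h0 ⟨i, hi⟩
    have hpos : ∃ v ∈ b, g v ≠ 0 := by
      by_contra! hc
      have h1 : b ⊆ (LinearMap.ker g : Set (Fin m → ℝ)) := fun v hv => hc v hv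
      have h2 : U i ∈ Submodule.span ℝ b := by
        rw [hspan]; exact Submodule.subset_span ⟨i, rfl⟩
      exact hi (Submodule.span_le.2 h1 h2)
    obtain ⟨v, hv, hgv⟩ := hpos
    obtain ⟨j, rfl⟩ := hb hv
    have hj : 1 ≤ g (U j) := by
      obtain ⟨z, hz⟩ := hz j
      have h3 := h0 j
      rw [hz] at h3 hgv ⊢
      have h4 : (0 : ℤ) ≤ z := by exact_mod_cast h3
      have h5 : z ≠ 0 := by rintro rfl; simp at hgv
      have h6 : (1 : ℤ) ≤ z := by omega
      exact_mod_cast h6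
    rw [map_sum]
    refine hj.trans (Finset.single_le_sum (f := fun v => g v) (fun v hv => ?_)
      (hfin.mem_toFinset.2 hv))
    obtain ⟨k, rfl⟩ := hb (hfin.mem_toFinset.1 hv)
    exact h0 k

/-- A weight of controlled size for which all the gaps between labelled points are at least
one. -/
lemma exists_strict_weight (hl : ∀ a, 0 < lam a)
    {w : {b : Fin m // (q b : ℕ) ≠ 0} → Fin n → Fin m}
    (hw : ∀ b l, pt p q lam (.inr (b, l)) ∈ blk p lam (w b l)) :
    ∃ u : Fin m → ℝ, ∑ b, u b ≤ m * (Fintype.card (Lab q n) + 1) ∧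
      (∀ L L', pt p q lam L < pt p q lam L' → form p q w L u + 1 ≤ form p q w L' u) ∧
      ∀ L, form p q w L u + 1 ≤ ∑ b, u b := by
  choose U hz hzs hcard hmono hle hstrict hlast using exists_weight (p := p) hl hw
  obtain ⟨B, hBm, hB, hg⟩ := exists_sum_spanning U
  set tot : (Fin m → ℝ) →ₗ[ℝ] ℝ := ∑ b, LinearMap.proj b with htot
  have htot_apply : ∀ v, tot v = ∑ b, v b := fun v => by simp [htot, LinearMap.sum_apply]
  refine ⟨∑ v ∈ B, v, ?_, ?_, ?_⟩
  · rw [← htot_apply, map_sum]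
    calc ∑ v ∈ B, tot v ≤ ∑ v ∈ B, ((Fintype.card (Lab q n) : ℝ) + 1) := by
          refine Finset.sum_le_sum fun v hv => ?_
          obtain ⟨i, rfl⟩ := hB v hv
          rw [htot_apply]
          exact hcard i
      _ = B.card * ((Fintype.card (Lab q n) : ℝ) + 1) := by rw [Finset.sum_const, nsmul_eq_mul]
      _ ≤ _ := by gcongr
  · intro L L' h
    have := hg (form p q w L' - form p q w L) (fun i => ?_) (fun i => ?_) ⟨L, ?_⟩
    · rw [LinearMap.sub_apply] at this
      linarith
    · obtain ⟨z, hz1⟩ := hz i L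
      obtain ⟨z', hz2⟩ := hz i L'
      exact ⟨z' - z, by rw [LinearMap.sub_apply, hz1, hz2]; push_cast; rfl⟩
    · rw [LinearMap.sub_apply, sub_nonneg]
      exact hmono i L L' h.le
    · rw [LinearMap.sub_apply]
      have := hstrict L L' h
      intro h0
      linarith
  · intro L
    have := hg (tot - form p q w L) (fun i => ?_) (fun i => ?_) ⟨L, ?_⟩
    · rw [LinearMap.sub_apply, htot_apply] at this
      linarith
    · obtain ⟨z, hz1⟩ := hz i L
      obtain ⟨z', hz2⟩ := hzs i
      exact ⟨z' - z, by rw [LinearMap.sub_apply, htot_apply, hz1, hz2]; push_cast; rfl⟩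
    · rw [LinearMap.sub_apply, sub_nonneg, htot_apply]
      exact hle i L
    · rw [LinearMap.sub_apply, htot_apply]
      have := hlast L
      intro h0
      linarith

end weight

section generic

variable {p q : Equiv.Perm (Fin m)} {lam : Fin m → ℝ} {n : ℕ}

/-- There are no accidental coincidences among orbits of discontinuities, and no translation
along an orbit vanishes. -/
structure Generic (p q : Equiv.Perm (Fin m)) (lam : Fin m → ℝ) : Prop where
  sum_ne : ∀ N : Fin m → ℕ, N ≠ 0 → ∑ a, (N a : ℝ) * wv p q a lam ≠ 0
  off_ne : ∀ (N : Fin m → ℕ) (b a : Fin m), (q b : ℕ) ≠ 0 →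
    off q b lam + ∑ c, (N c : ℝ) * wv p q c lam ≠ off p a lam

lemma exists_iterate_eq (hl : ∀ a, 0 ≤ lam a) {x : ℝ} (hx : x ∈ Ico 0 (∑ b, lam b)) (k : ℕ) :
    ∃ N : Fin m → ℕ, ∑ a, N a = k ∧
      (trans p q lam)^[k] x = x + ∑ a, (N a : ℝ) * wv p q a lam := by
  induction k with
  | zero => exact ⟨0, by simp, by simp⟩
  | succ k ih =>
    obtain ⟨N, hN, h⟩ := ih
    obtain ⟨a, ha⟩ := exists_mem_blk (p := p) (iterate_trans_mem (p := p) (q := q) hl hx k)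
    refine ⟨N + Pi.single a 1, ?_, ?_⟩
    · simp [Finset.sum_add_distrib, hN]
    · rw [Function.iterate_succ_apply', trans_of_mem hl ha, h]
      simp only [Pi.add_apply, Nat.cast_add, add_mul, Finset.sum_add_distrib, add_assoc]
      congr 2
      simp [Pi.single_apply, ite_mul]

lemma iterate_injOn (hl : ∀ a, 0 ≤ lam a) (k : ℕ) :
    InjOn (trans p q lam)^[k] (Ico 0 (∑ b, lam b)) := by
  induction k with
  | zero => exact fun x _ y _ h => h
  | succ k ih =>
    intro x hx y hy h
    rw [Function.iterate_succ_apply', Function.iterate_succ_apply'] at h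
    exact ih hx hy (trans_injOn hl (iterate_trans_mem hl hx k) (iterate_trans_mem hl hy k) h)

lemma Generic.iterate_off_ne (hg : Generic p q lam) (hl : ∀ a, 0 < lam a) (a b : Fin m)
    (hb : (q b : ℕ) ≠ 0) (k : ℕ) : (trans p q lam)^[k] (off q b lam) ≠ off p a lam := by
  obtain ⟨N, -, hN⟩ := exists_iterate_eq (p := p) (q := q) (fun a => (hl a).le) (off_mem hl b) k
  rw [hN]
  exact hg.off_ne N b a hb

lemma Generic.pt_injective (hg : Generic p q lam) (hl : ∀ a, 0 < lam a) :
    Function.Injective (pt p q lam : Lab q n → ℝ) := by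
  have hl0 : ∀ a, 0 ≤ lam a := fun a => (hl a).le
  have key : ∀ (b b' : Fin m) (l k : ℕ), (q b' : ℕ) ≠ 0 →
      (trans p q lam)^[l] (off q b lam) = (trans p q lam)^[l + k] (off q b' lam) →
      k = 0 ∧ b = b' := by
    intro b b' l k hb' h
    rw [Function.iterate_add_apply] at h
    have h1 := iterate_injOn hl0 l (off_mem hl b) (iterate_trans_mem hl0 (off_mem hl b') k) h
    cases k with
    | zero =>
      refine ⟨rfl, blk_unique (p := q) hl0 (x := off q b lam) ?_ ?_⟩
      · exact ⟨le_rfl, by linarith [hl b]⟩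
      · rw [h1]; exact ⟨le_rfl, by simp [hl b']⟩
    | succ k =>
      exfalso
      rw [Function.iterate_succ_apply', ← trans_off (p := p) (q := q) hl b] at h1
      exact hg.iterate_off_ne hl b b' hb' k (trans_injOn hl0 (off_mem hl b)
        (iterate_trans_mem hl0 (off_mem hl b') k) h1).symm
  rintro (a | ⟨b, l⟩) (a' | ⟨b', l'⟩) h
  · congr 1
    refine blk_unique (p := p) hl0 (x := off p a lam) ⟨le_rfl, by linarith [hl a]⟩ ?_
    rw [show off p a lam = off p a' lam from h]
    exact ⟨le_rfl, by linarith [hl a']⟩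
  · exact absurd h.symm (hg.iterate_off_ne hl a b' b'.2 l')
  · exact absurd h (hg.iterate_off_ne hl a' b b.2 l)
  · simp only [pt] at h
    rcases le_total (l : ℕ) l' with hle | hle
    · obtain ⟨k, hk⟩ := Nat.exists_eq_add_of_le hle
      rw [hk] at h
      obtain ⟨h1, h2⟩ := key _ _ _ _ b'.2 h
      congr 2
      · exact Subtype.ext h2
      · exact Fin.ext (by omega)
    · obtain ⟨k, hk⟩ := Nat.exists_eq_add_of_le hle
      rw [hk] at h
      obtain ⟨h1, h2⟩ := key _ _ _ _ b.2 h.symm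
      congr 2
      · exact Subtype.ext h2.symm
      · exact Fin.ext (by omega)

lemma measure_ker_eq_zero (g : (Fin m → ℝ) →ₗ[ℝ] ℝ) {τ : Fin m → ℝ} (h : g τ ≠ 0) :
    volume {lam : Fin m → ℝ | g lam = 0} = 0 := by
  have : LinearMap.ker g ≠ ⊤ := by
    intro hc
    have : τ ∈ LinearMap.ker g := by rw [hc]; trivial
    exact h this
  exact Measure.addHaar_submodule volume (LinearMap.ker g) this

/-- A combinatorial nondegeneracy condition on a pair of orders, in the form of a suspension
datum. -/
structure Suspended (p q : Equiv.Perm (Fin m)) (τ : Fin m → ℝ) : Prop where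
  top_pos : ∀ a, (p a : ℕ) ≠ 0 → 0 < off p a τ
  bot_neg : ∀ a, (q a : ℕ) ≠ 0 → off q a τ < 0
  ne_or_ne : ∀ a, (p a : ℕ) ≠ 0 ∨ (q a : ℕ) ≠ 0

lemma Suspended.top_nonneg {τ : Fin m → ℝ} (h : Suspended p q τ) (a : Fin m) :
    0 ≤ off p a τ := by
  by_cases h0 : (p a : ℕ) = 0
  · rw [off_eq_zero h0]
  · exact (h.top_pos a h0).le

lemma Suspended.bot_nonpos {τ : Fin m → ℝ} (h : Suspended p q τ) (a : Fin m) :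
    off q a τ ≤ 0 := by
  by_cases h0 : (q a : ℕ) = 0
  · rw [off_eq_zero h0]
  · exact (h.bot_neg a h0).le

lemma Suspended.wv_neg {τ : Fin m → ℝ} (h : Suspended p q τ) (a : Fin m) :
    wv p q a τ < 0 := by
  rw [wv, LinearMap.sub_apply]
  rcases h.ne_or_ne a with h1 | h1
  · linarith [h.top_pos a h1, h.bot_nonpos a]
  · linarith [h.bot_neg a h1, h.top_nonneg a]

lemma Suspended.swap {τ : Fin m → ℝ} (h : Suspended p q τ) : Suspended q p (-τ) where
  top_pos a ha := by rw [map_neg]; linarith [h.bot_neg a ha]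
  bot_neg a ha := by rw [map_neg]; linarith [h.top_pos a ha]
  ne_or_ne a := (h.ne_or_ne a).symm

lemma Suspended.ae_generic {τ : Fin m → ℝ} (h : Suspended p q τ) :
    ∀ᵐ lam ∂(volume : Measure (Fin m → ℝ)), Generic p q lam := by
  have h1 : ∀ N : Fin m → ℕ, ∀ᵐ lam ∂(volume : Measure (Fin m → ℝ)), N ≠ 0 →
      ∑ a, (N a : ℝ) * wv p q a lam ≠ 0 := by
    intro N
    by_cases hN : N = 0
    · exact Filter.Eventually.of_forall fun _ h => absurd hN h
    have := measure_ker_eq_zero (∑ a, (N a : ℝ) • wv p q a) (τ := τ) (by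
      simp only [LinearMap.sum_apply, LinearMap.smul_apply, smul_eq_mul]
      refine ne_of_lt ?_
      obtain ⟨a, ha⟩ := Function.ne_iff.1 hN
      refine Finset.sum_neg' (fun b _ => ?_) ⟨a, Finset.mem_univ a, ?_⟩
      · exact mul_nonpos_of_nonneg_of_nonpos (Nat.cast_nonneg _) (h.wv_neg b).le
      · exact mul_neg_of_pos_of_neg (Nat.cast_pos.2 (Nat.pos_of_ne_zero ha)) (h.wv_neg a))
    filter_upwards [measure_eq_zero_iff_ae_notMem.1 this] with lam hlam _
    simpa [LinearMap.sum_apply] using hlam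
  have h2 : ∀ (N : Fin m → ℕ) (b a : Fin m), ∀ᵐ lam ∂(volume : Measure (Fin m → ℝ)),
      (q b : ℕ) ≠ 0 → off q b lam + ∑ c, (N c : ℝ) * wv p q c lam ≠ off p a lam := by
    intro N b a
    by_cases hb : (q b : ℕ) = 0
    · exact Filter.Eventually.of_forall fun _ h => absurd hb h
    have := measure_ker_eq_zero (off q b + ∑ c, (N c : ℝ) • wv p q c - off p a) (τ := τ) (by
      simp only [LinearMap.sub_apply, LinearMap.add_apply, LinearMap.sum_apply,
        LinearMap.smul_apply, smul_eq_mul]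
      have h3 : ∑ c, (N c : ℝ) * wv p q c τ ≤ 0 := Finset.sum_nonpos fun c _ =>
        mul_nonpos_of_nonneg_of_nonpos (Nat.cast_nonneg _) (h.wv_neg c).le
      have := h.bot_neg b hb
      have := h.top_nonneg a
      refine ne_of_lt ?_
      linarith)
    filter_upwards [measure_eq_zero_iff_ae_notMem.1 this] with lam hlam _
    simpa [LinearMap.sum_apply, sub_eq_zero] using hlam
  filter_upwards [ae_all_iff.2 h1, ae_all_iff.2 fun N => ae_all_iff.2 fun b =>
    ae_all_iff.2 (h2 N b)] with lam h3 h4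
  exact ⟨h3, h4⟩

end generic

section region

variable {p q : Equiv.Perm (Fin m)} {lam : Fin m → ℝ} {n : ℕ}

/-- The labelled points are `ρ`-separated, and `ρ`-far from the right end. -/
def Good (p q : Equiv.Perm (Fin m)) (n : ℕ) (ρ : ℝ) (lam : Fin m → ℝ) : Prop :=
  (∀ L L' : Lab q n, L ≠ L' → ρ ≤ |pt p q lam L - pt p q lam L'|) ∧
    ∀ L : Lab q n, pt p q lam L + ρ ≤ ∑ b, lam b

lemma Good.mono {ρ ρ' : ℝ} (h : Good p q n ρ lam) (hρ : ρ' ≤ ρ) : Good p q n ρ' lam :=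
  ⟨fun L L' hL => hρ.trans (h.1 L L' hL), fun L => le_trans (by linarith) (h.2 L)⟩

/-- The length vectors with prescribed itineraries and prescribed order of labelled points. -/
def region (p q : Equiv.Perm (Fin m)) (w : {b : Fin m // (q b : ℕ) ≠ 0} → Fin n → Fin m)
    (ord : Lab q n → Lab q n → Prop) : Set (Fin m → ℝ) :=
  {lam | (∀ a, 0 < lam a) ∧ (∀ b l, form p q w (.inr (b, l)) lam ∈ blk p lam (w b l)) ∧
    ∀ L L', ord L L' ↔ form p q w L lam < form p q w L' lam}

lemma measurable_linear (g : (Fin m → ℝ) →ₗ[ℝ] ℝ) : Measurable g :=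
  (LinearMap.continuous_of_finiteDimensional g).measurable

lemma measurableSet_region (w : {b : Fin m // (q b : ℕ) ≠ 0} → Fin n → Fin m)
    (ord : Lab q n → Lab q n → Prop) : MeasurableSet (region p q w ord) := by
  have h1 : MeasurableSet {lam : Fin m → ℝ | ∀ a, 0 < lam a} :=
    measurableSet_setOfPred.2 (Measurable.forall fun a =>
      measurableSet_setOfPred.1 (measurableSet_lt measurable_const (measurable_pi_apply a)))
  have h2 : MeasurableSet {lam : Fin m → ℝ | ∀ b l,
      form p q w (.inr (b, l)) lam ∈ blk p lam (w b l)} := by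
    refine measurableSet_setOfPred.2 (Measurable.forall fun b => Measurable.forall fun l => ?_)
    refine measurableSet_setOfPred.1 (MeasurableSet.inter
      (measurableSet_le (measurable_linear _) (measurable_linear _))
      (measurableSet_lt (measurable_linear _) ?_))
    exact (measurable_linear _).add (measurable_pi_apply _)
  have h3 : MeasurableSet {lam : Fin m → ℝ | ∀ L L',
      ord L L' ↔ form p q w L lam < form p q w L' lam} := by
    refine measurableSet_setOfPred.2 (Measurable.forall fun L => Measurable.forall fun L' => ?_)
    exact measurable_const.iff (measurableSet_setOfPred.1
      (measurableSet_lt (measurable_linear _) (measurable_linear _)))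
  exact h1.inter (h2.inter h3)

lemma exists_mem_region (hl : ∀ a, 0 < lam a) :
    ∃ (w : {b : Fin m // (q b : ℕ) ≠ 0} → Fin n → Fin m) (ord : Lab q n → Lab q n → Prop),
      lam ∈ region p q w ord := by
  have h : ∀ (b : {b : Fin m // (q b : ℕ) ≠ 0}) (l : Fin n),
      ∃ a, pt p q lam (.inr (b, l)) ∈ blk p lam a := fun b l => exists_mem_blk (pt_mem hl _)
  choose w hw using h
  have hform := form_eq_pt (fun a => (hl a).le) (fun b l => Or.inr (hw b l))
  refine ⟨w, fun L L' => form p q w L lam < form p q w L' lam, hl, fun b l => ?_,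
    fun L L' => Iff.rfl⟩
  rw [hform]
  exact hw b l

lemma form_eq_pt_of_mem_region {w : {b : Fin m // (q b : ℕ) ≠ 0} → Fin n → Fin m}
    {ord : Lab q n → Lab q n → Prop} (h : lam ∈ region p q w ord) (L : Lab q n) :
    form p q w L lam = pt p q lam L :=
  form_eq_pt (fun a => (h.1 a).le) (fun b l => Or.inl (h.2.1 b l)) L

lemma region_unique {w w' : {b : Fin m // (q b : ℕ) ≠ 0} → Fin n → Fin m}
    {ord ord' : Lab q n → Lab q n → Prop} (h : lam ∈ region p q w ord)
    (h' : lam ∈ region p q w' ord') : w = w' ∧ ord = ord' := by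
  have hw : w = w' := by
    funext b l
    have h1 := h.2.1 b l
    have h2 := h'.2.1 b l
    rw [form_eq_pt_of_mem_region h] at h1
    rw [form_eq_pt_of_mem_region h'] at h2
    exact blk_unique (fun a => (h.1 a).le) h1 h2
  subst hw
  refine ⟨rfl, ?_⟩
  funext L L'
  exact propext ((h.2.2 L L').trans (h'.2.2 L L').symm)

/-- Weights on which all gaps are at least `δ` in the region's order. -/
structure IsStrict (p q : Equiv.Perm (Fin m))
    (w : {b : Fin m // (q b : ℕ) ≠ 0} → Fin n → Fin m)
    (ord : Lab q n → Lab q n → Prop) (δ : ℝ) (c : Fin m → ℝ) : Prop where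
  pos : ∀ a, 0 < c a
  mem : ∀ b l, form p q w (.inr (b, l)) c ∈ blk p c (w b l)
  gap : ∀ L L', ord L L' → form p q w L c + δ ≤ form p q w L' c
  last : ∀ L, form p q w L c + δ ≤ ∑ b, c b

lemma exists_isStrict {w : {b : Fin m // (q b : ℕ) ≠ 0} → Fin n → Fin m}
    {ord : Lab q n → Lab q n → Prop} (h : lam ∈ region p q w ord) (hg : Generic p q lam)
    {K : ℝ} (hK : 0 < K) (hK' : m * ((Fintype.card (Lab q n) : ℝ) + 1) ≤ K) :
    ∃ c, IsStrict p q w ord (1 / K) c ∧ ∑ b, c b ≤ 1 := by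
  have hl := h.1
  have hform := form_eq_pt_of_mem_region h
  have hinj := hg.pt_injective (n := n) hl
  obtain ⟨u, hu, hgap, hlast⟩ := exists_strict_weight (p := p) hl (w := w) (fun b l => by
    rw [← hform]; exact h.2.1 b l)
  have hnext : ∀ a, off p a lam + lam a = ∑ b, lam b ∧ off p a u + u a = ∑ b, u b ∨
      ∃ a', off p a' lam = off p a lam + lam a ∧ off p a' u = off p a u + u a := by
    intro a
    by_cases ha : (p a : ℕ) + 1 = m
    · exact Or.inl ⟨off_add_eq_sum ha, off_add_eq_sum ha⟩
    · have : (p a : ℕ) + 1 < m := by have := (p a).2; omega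
      exact Or.inr ⟨p.symm ⟨p a + 1, this⟩, off_add_eq_off (by simp), off_add_eq_off (by simp)⟩
  have hlt : ∀ (L : Lab q n) a, pt p q lam L < off p a lam + lam a →
      form p q w L u < off p a u + u a := by
    intro L a hL
    rcases hnext a with ⟨h1, h2⟩ | ⟨a', h1, h2⟩
    · rw [h2]; linarith [hlast L]
    · rw [← h2]
      have := hgap L (.inl a') (by rw [← h1] at hL; exact hL)
      simp only [form] at this ⊢
      linarith
  refine ⟨fun a => u a / K, ?_, ?_⟩
  · have hcu : (fun a => u a / K) = K⁻¹ • u := by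
      funext a; simp [div_eq_inv_mul]
    have hK1 : 0 < K⁻¹ := inv_pos.2 hK
    constructor
    · intro a
      have := hlt (.inl a) a (by simp [pt, hl a])
      simp only [form] at this
      exact div_pos (by linarith) hK
    · intro b l
      have h1 := h.2.1 b l
      rw [hform] at h1
      have h2 := hlt _ _ h1.2
      have h3 : off p (w b l) u ≤ form p q w (.inr (b, l)) u := by
        have := hgap (.inl (w b l)) (.inr (b, l)) (lt_of_le_of_ne h1.1 fun he => by
          have := @hinj (.inl (w b l)) (.inr (b, l)) he
          simp at this)
        simp only [form] at this ⊢
        linarith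
      rw [hcu]
      simp only [blk, mem_Ico, map_smul, smul_eq_mul, Pi.smul_apply, ← mul_add]
      exact ⟨mul_le_mul_of_nonneg_left h3 hK1.le, mul_lt_mul_of_pos_left h2 hK1⟩
    · intro L L' hL
      have := hgap L L' (by rw [← hform, ← hform]; exact (h.2.2 L L').1 hL)
      rw [hcu, map_smul, map_smul, smul_eq_mul, smul_eq_mul, one_div]
      nlinarith
    · intro L
      have := hlast L
      have h1 : ∑ b, u b / K = K⁻¹ * ∑ b, u b := by
        rw [← Finset.sum_div, div_eq_inv_mul]
      rw [h1, hcu, map_smul, smul_eq_mul, one_div]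
      nlinarith
  · rw [← Finset.sum_div]
    exact div_le_one_of_le₀ (hu.trans hK') hK.le

lemma IsStrict.convex {w : {b : Fin m // (q b : ℕ) ≠ 0} → Fin n → Fin m}
    {ord : Lab q n → Lab q n → Prop} {δ : ℝ} (hδ : 0 < δ) {c : Fin m → ℝ}
    (hc : IsStrict p q w ord δ c) (htot : ∀ L L', L ≠ L' → ord L L' ∨ ord L' L)
    (h : lam ∈ region p q w ord) {s : ℝ} (h0 : 0 < s) (h1 : s < 1) :
    (1 - s) • lam + s • c ∈ region p q w ord ∧ Good p q n (s * δ) ((1 - s) • lam + s • c) := by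
  have h1' : 0 < 1 - s := by linarith
  have hgap : ∀ L L', ord L L' → form p q w L ((1 - s) • lam + s • c) + s * δ ≤
      form p q w L' ((1 - s) • lam + s • c) := by
    intro L L' hL
    have e1 := (h.2.2 L L').1 hL
    have e2 := hc.gap L L' hL
    simp only [map_add, map_smul, smul_eq_mul]
    nlinarith
  have hmem : (1 - s) • lam + s • c ∈ region p q w ord := by
    refine ⟨fun a => ?_, fun b l => ?_, fun L L' => ⟨fun hL => ?_, fun hL => ?_⟩⟩
    · simp only [Pi.add_apply, Pi.smul_apply, smul_eq_mul]
      exact add_pos (mul_pos h1' (h.1 a)) (mul_pos h0 (hc.pos a))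
    · have e1 := h.2.1 b l
      have e2 := hc.mem b l
      simp only [blk, mem_Ico, map_add, map_smul, smul_eq_mul, Pi.add_apply,
        Pi.smul_apply] at e1 e2 ⊢
      constructor <;> nlinarith
    · have := hgap L L' hL
      have := mul_pos h0 hδ
      linarith
    · by_contra hcon
      rcases eq_or_ne L L' with rfl | hne
      · exact lt_irrefl _ hL
      · have e1 := hgap L' L ((htot L L' hne).resolve_left hcon)
        have := mul_pos h0 hδ
        linarith
  refine ⟨hmem, fun L L' hne => ?_, fun L => ?_⟩
  · rw [← form_eq_pt_of_mem_region hmem, ← form_eq_pt_of_mem_region hmem]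
    rcases htot L L' hne with hL | hL
    · have := hgap _ _ hL
      exact le_trans (by linarith) (neg_le_abs _)
    · have := hgap _ _ hL
      exact le_trans (by linarith) (le_abs_self _)
  · rw [← form_eq_pt_of_mem_region hmem]
    have e1 := hc.last L
    have e2 : form p q w L lam ≤ ∑ b, lam b := by
      rw [form_eq_pt_of_mem_region h]; exact (pt_mem h.1 L).2.le
    simp only [map_add, map_smul, smul_eq_mul, Pi.add_apply, Pi.smul_apply,
      Finset.sum_add_distrib, ← Finset.mul_sum]
    nlinarith

end region

section estimate

variable {p q : Equiv.Perm (Fin m)} {n : ℕ}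

/-- Positive length vectors of total length less than `M`. -/
def simplexLT (m : ℕ) (M : ℝ) : Set (Fin m → ℝ) := {lam | (∀ a, 0 < lam a) ∧ ∑ b, lam b < M}

lemma volume_simplexLT_ne_top (M : ℝ) : volume (simplexLT m M) ≠ ⊤ := by
  have : simplexLT m M ⊆ Icc 0 (fun _ => M) := fun lam h => ⟨fun a => (h.1 a).le, fun a =>
    (Finset.single_le_sum (fun b _ => (h.1 b).le) (Finset.mem_univ a)).trans h.2.le⟩
  exact ((measure_mono this).trans_lt isCompact_Icc.measure_lt_top).ne

lemma measurable_sum_coord : Measurable fun lam : Fin m → ℝ => ∑ b, lam b :=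
  Finset.measurable_sum _ fun a _ => measurable_pi_apply a

/-- Positive generic length vectors of total length less than `M` which fail to be
`ρ`-separated up to time `n`. -/
def badSet (p q : Equiv.Perm (Fin m)) (n : ℕ) (M ρ : ℝ) : Set (Fin m → ℝ) :=
  {lam | lam ∈ simplexLT m M ∧ Generic p q lam ∧ ¬ Good p q n ρ lam}

lemma volume_badSet_inter_region_le {M s K : ℝ} (hM : 1 ≤ M) (h0 : 0 < s) (h1 : s < 1)
    (hK : 0 < K) (hK' : m * ((Fintype.card (Lab q n) : ℝ) + 1) ≤ K)
    (w : {b : Fin m // (q b : ℕ) ≠ 0} → Fin n → Fin m) (ord : Lab q n → Lab q n → Prop) :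
    volume (badSet p q n M (s / K) ∩ region p q w ord) ≤
      ENNReal.ofReal (1 - (1 - s) ^ m) * volume (simplexLT m M ∩ region p q w ord) := by
  by_cases hex : ∃ lam ∈ region p q w ord, Generic p q lam
  swap
  · have : badSet p q n M (s / K) ∩ region p q w ord = ∅ := by
      by_contra hne
      obtain ⟨lam, hb, hr⟩ := nonempty_iff_ne_empty.2 hne
      exact hex ⟨lam, hr, hb.2.1⟩
    simp [this]
  obtain ⟨lam₀, hr₀, hg₀⟩ := hex
  obtain ⟨c, hc, hc1⟩ := exists_isStrict hr₀ hg₀ hK hK'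
  have htot : ∀ L L', L ≠ L' → ord L L' ∨ ord L' L := by
    intro L L' hne
    rw [hr₀.2.2, hr₀.2.2, form_eq_pt_of_mem_region hr₀, form_eq_pt_of_mem_region hr₀]
    exact lt_or_gt_of_ne fun h => hne (hg₀.pt_injective hr₀.1 h)
  set R := simplexLT m M ∩ region p q w ord with hR
  have hRm : MeasurableSet R := by
    have : R = region p q w ord ∩ {lam | ∑ b, lam b < M} := by
      ext lam
      simp only [hR, simplexLT, mem_inter_iff, mem_ofPred_eq]
      exact ⟨fun h => ⟨h.2, h.1.2⟩, fun h => ⟨⟨h.1.1, h.2⟩, h.1⟩⟩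
    rw [this]
    exact (measurableSet_region w ord).inter
      (measurableSet_lt measurable_sum_coord measurable_const)
  have h1' : 0 < 1 - s := by linarith
  have happ : ∀ lam, AffineMap.homothety c (1 - s) lam = (1 - s) • lam + s • c := by
    intro lam
    rw [AffineMap.homothety_apply, vsub_eq_sub, vadd_eq_add, smul_sub, sub_smul, sub_smul]
    simp only [one_smul]
    abel
  set A := AffineMap.homothety c (1 - s) '' R with hA
  have hAR : A ⊆ R ∩ {lam | Good p q n (s / K) lam} := by
    rintro _ ⟨lam, hlam, rfl⟩
    rw [happ]
    obtain ⟨e1, e2⟩ := hc.convex (one_div_pos.2 hK) htot hlam.2 h0 h1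
    refine ⟨⟨⟨e1.1, ?_⟩, e1⟩, ?_⟩
    · have := hlam.1.2
      simp only [Pi.add_apply, Pi.smul_apply, smul_eq_mul, Finset.sum_add_distrib,
        ← Finset.mul_sum]
      nlinarith
    · rwa [mul_one_div] at e2
  have hAm : MeasurableSet A := by
    refine hRm.image_of_continuousOn_injOn (Continuous.continuousOn ?_) fun x _ y _ hxy => ?_
    · simp only [funext happ]; fun_prop
    · rw [happ, happ, add_left_inj] at hxy
      exact smul_right_injective _ h1'.ne' hxy
  have hfin : volume R ≠ ⊤ :=
    (lt_of_le_of_lt (measure_mono inter_subset_left)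
      (lt_top_iff_ne_top.2 (volume_simplexLT_ne_top M))).ne
  have hvol : volume A = ENNReal.ofReal ((1 - s) ^ m) * volume R := by
    rw [hA, Measure.addHaar_image_homothety, Module.finrank_fin_fun,
      abs_of_nonneg (pow_nonneg h1'.le _)]
  have hle : volume A ≤ volume R := measure_mono (hAR.trans inter_subset_left)
  calc volume (badSet p q n M (s / K) ∩ region p q w ord) ≤ volume (R \ A) :=
        measure_mono fun lam h => ⟨⟨h.1.1, h.2⟩, fun hlamA => h.1.2.2 (hAR hlamA).2⟩
    _ = volume R - volume A :=
        measure_sdiff (hAR.trans inter_subset_left) hAm.nullMeasurableSet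
          (hle.trans_lt (lt_top_iff_ne_top.2 hfin)).ne
    _ = ENNReal.ofReal (1 - (1 - s) ^ m) * volume R := by
        rw [hvol, ENNReal.ofReal_sub _ (pow_nonneg h1'.le _), ENNReal.sub_mul fun _ _ => hfin,
          ENNReal.ofReal_one, one_mul]

lemma volume_badSet_le {M s K : ℝ} (hM : 1 ≤ M) (h0 : 0 < s) (h1 : s < 1)
    (hK : 0 < K) (hK' : m * ((Fintype.card (Lab q n) : ℝ) + 1) ≤ K) :
    volume (badSet p q n M (s / K)) ≤
      ENNReal.ofReal (1 - (1 - s) ^ m) * volume (simplexLT m M) := by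
  set ι := ({b : Fin m // (q b : ℕ) ≠ 0} → Fin n → Fin m) × (Lab q n → Lab q n → Prop)
  have hcount : Countable ι := Finite.to_countable
  set R : ι → Set (Fin m → ℝ) := fun κ => simplexLT m M ∩ region p q κ.1 κ.2 with hR
  have hcover : badSet p q n M (s / K) ⊆
      ⋃ κ : ι, badSet p q n M (s / K) ∩ region p q κ.1 κ.2 := by
    intro lam h
    obtain ⟨w, ord, hr⟩ := exists_mem_region (p := p) (q := q) (n := n) h.1.1
    exact mem_iUnion.2 ⟨(w, ord), h, hr⟩
  have hdisj : Pairwise (Function.onFun Disjoint R) := by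
    intro κ κ' hne
    refine Set.disjoint_left.2 fun lam h h' => hne ?_
    obtain ⟨e1, e2⟩ := region_unique h.2 h'.2
    exact Prod.ext e1 e2
  have hmeas : ∀ κ, MeasurableSet (R κ) := by
    intro κ
    have : R κ = region p q κ.1 κ.2 ∩ {lam | ∑ b, lam b < M} := by
      ext lam
      simp only [hR, simplexLT, mem_inter_iff, mem_ofPred_eq]
      exact ⟨fun h => ⟨h.2, h.1.2⟩, fun h => ⟨⟨h.1.1, h.2⟩, h.1⟩⟩
    rw [this]
    exact (measurableSet_region _ _).inter
      (measurableSet_lt measurable_sum_coord measurable_const)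
  calc volume (badSet p q n M (s / K))
      ≤ ∑' κ : ι, volume (badSet p q n M (s / K) ∩ region p q κ.1 κ.2) :=
        (measure_mono hcover).trans (measure_iUnion_le _)
    _ ≤ ∑' κ : ι, ENNReal.ofReal (1 - (1 - s) ^ m) * volume (R κ) :=
        ENNReal.tsum_le_tsum fun κ =>
          volume_badSet_inter_region_le hM h0 h1 hK hK' κ.1 κ.2
    _ = ENNReal.ofReal (1 - (1 - s) ^ m) * volume (⋃ κ, R κ) := by
        rw [ENNReal.tsum_mul_left, measure_iUnion hdisj hmeas]
    _ ≤ _ := by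
        gcongr
        exact iUnion_subset fun κ => inter_subset_left

lemma card_lab_le (hm : 1 ≤ m) (hn : 1 ≤ n) :
    (m : ℝ) * ((Fintype.card (Lab q n) : ℝ) + 1) ≤ 3 * m ^ 2 * n := by
  have h1 : Fintype.card (Lab q n) ≤ m + m * n := by
    rw [Fintype.card_sum, Fintype.card_prod, Fintype.card_fin, Fintype.card_fin]
    gcongr
    exact (Fintype.card_subtype_le _).trans (Fintype.card_fin m).le
  have h2 : (Fintype.card (Lab q n) : ℝ) ≤ m + m * n := by exact_mod_cast h1
  have h3 : (1 : ℝ) ≤ m := by exact_mod_cast hm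
  have h4 : (1 : ℝ) ≤ n := by exact_mod_cast hn
  have h5 : (m : ℝ) ≤ m * n := by nlinarith
  have h6 : (1 : ℝ) ≤ m * n := by nlinarith
  calc (m : ℝ) * ((Fintype.card (Lab q n) : ℝ) + 1) ≤ m * (m * n + m * n + m * n) := by
        gcongr
        linarith
    _ = _ := by ring

/-- The set of length vectors that are eventually bad is small. -/
lemma volume_eventually_bad_le (hm : 1 ≤ m) {M s : ℝ} (hM : 1 ≤ M) (h0 : 0 < s) (h1 : s < 1) :
    volume (⋃ N : ℕ, ⋂ n : ℕ, ⋂ _ : N ≤ n, badSet p q n M (s / (3 * m ^ 2 * n))) ≤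
      ENNReal.ofReal (1 - (1 - s) ^ m) * volume (simplexLT m M) := by
  have hmono : Monotone fun N : ℕ =>
      ⋂ n : ℕ, ⋂ _ : N ≤ n, badSet p q n M (s / (3 * m ^ 2 * n)) := by
    intro N N' hN lam h
    simp only [mem_iInter] at h ⊢
    exact fun n hn => h n (hN.trans hn)
  rw [hmono.measure_iUnion]
  refine iSup_le fun N => ?_
  refine (measure_mono (iInter₂_subset (N + 1) (Nat.le_succ N))).trans ?_
  refine volume_badSet_le hM h0 h1 ?_ (card_lab_le hm (by omega))
  have : (0 : ℝ) < m := by exact_mod_cast hm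
  positivity

/-- Almost every length vector has, for some `s > 0`, `s / n`-separated labelled points for
infinitely many `n`. -/
lemma Suspended.ae_frequently_good {τ : Fin m → ℝ} (hτ : Suspended p q τ) (hm : 1 ≤ m) :
    ∀ᵐ lam ∂(volume : Measure (Fin m → ℝ)), (∀ a, 0 < lam a) →
      ∃ s > 0, ∃ᶠ n : ℕ in Filter.atTop, Good p q n (s / n) lam := by
  have hnull : ∀ M : ℕ, volume (⋂ k : ℕ, ⋃ N : ℕ, ⋂ n : ℕ, ⋂ _ : N ≤ n,
      badSet p q n ((M : ℝ) + 1) ((1 / ((k : ℝ) + 2)) / (3 * m ^ 2 * n))) = 0 := by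
    intro M
    have hlim : Filter.Tendsto (fun k : ℕ => ENNReal.ofReal
        (1 - (1 - 1 / ((k : ℝ) + 2)) ^ m) * volume (simplexLT m ((M : ℝ) + 1)))
        Filter.atTop (nhds (ENNReal.ofReal (1 - (1 - 0) ^ m) *
          volume (simplexLT m ((M : ℝ) + 1)))) := by
      refine ENNReal.Tendsto.mul_const (ENNReal.tendsto_ofReal ?_)
        (Or.inr (volume_simplexLT_ne_top _))
      refine Filter.Tendsto.const_sub _ (Filter.Tendsto.pow (Filter.Tendsto.const_sub _ ?_) _)
      refine Filter.Tendsto.div_atTop tendsto_const_nhds ?_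
      exact Filter.tendsto_atTop_add_const_right _ _ tendsto_natCast_atTop_atTop
    simp only [sub_zero, one_pow, sub_self, ENNReal.ofReal_zero, zero_mul] at hlim
    refine le_antisymm (ge_of_tendsto' hlim fun k => ?_) zero_le
    refine (measure_mono (iInter_subset _ k)).trans
      (volume_eventually_bad_le hm (by linarith [(Nat.cast_nonneg M : (0 : ℝ) ≤ M)])
        (by positivity) ?_)
    rw [div_lt_one (by positivity)]
    linarith [(Nat.cast_nonneg k : (0 : ℝ) ≤ k)]
  filter_upwards [hτ.ae_generic, ae_all_iff.2 fun M => measure_eq_zero_iff_ae_notMem.1 (hnull M)]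
    with lam hg hlam hpos
  obtain ⟨M, hM⟩ := exists_nat_gt (∑ b, lam b)
  have := hlam M
  simp only [mem_iInter, mem_iUnion, not_forall, not_exists] at this
  obtain ⟨k, hk⟩ := this
  have hm0 : (0 : ℝ) < m := by exact_mod_cast hm
  refine ⟨1 / ((k : ℝ) + 2) / (3 * m ^ 2), by positivity, ?_⟩
  rw [Filter.frequently_atTop]
  intro N
  obtain ⟨n, hn, hbad⟩ := hk N
  refine ⟨n, hn, ?_⟩
  rw [div_div]
  by_contra hcon
  exact hbad ⟨⟨hpos, by linarith⟩, hg, hcon⟩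

end estimate

section carry

variable {p q : Equiv.Perm (Fin m)} {lam : Fin m → ℝ} {e : Fin m → ℂ} {f : ℝ → ℂ}

/-- `f` solves the cohomological equation with multiplier `e a` on the interval of `a`. -/
def Solves (p q : Equiv.Perm (Fin m)) (lam : Fin m → ℝ) (e : Fin m → ℂ) (f : ℝ → ℂ) : Prop :=
  ∀ a, ∀ᵐ x ∂(volume : Measure ℝ), x ∈ blk p lam a → f (x + wv p q a lam) = e a * f x

lemma ae_add_right {P : ℝ → Prop} (h : ∀ᵐ x ∂(volume : Measure ℝ), P x) (d : ℝ) :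
    ∀ᵐ x ∂(volume : Measure ℝ), P (x + d) :=
  (measurePreserving_add_right volume d).quasiMeasurePreserving.ae h

lemma Solves.swap (h : Solves p q lam e f) (he : ∀ a, ‖e a‖ = 1) :
    Solves q p lam (fun a => (e a)⁻¹) f := by
  intro a
  filter_upwards [ae_add_right (h a) (wv q p a lam)] with x hx hxa
  have hw : wv q p a lam = - wv p q a lam := by simp [wv]
  have h1 : x + wv q p a lam ∈ blk p lam a := by
    simp only [wv, blk, mem_Ico, LinearMap.sub_apply] at hxa ⊢
    constructor <;> linarith [hxa.1, hxa.2]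
  have h2 := hx h1
  rw [hw] at h2 ⊢
  rw [neg_add_cancel_right] at h2
  have h3 : e a ≠ 0 := fun h0 => by simpa [h0] using he a
  rw [h2, inv_mul_cancel_left₀ h3]

/-- The `k`-th iterate is the translation by `d` on `[x, y)`, and `f` changes by a unimodular
factor along it. -/
structure Carries (p q : Equiv.Perm (Fin m)) (lam : Fin m → ℝ) (f : ℝ → ℂ) (x y : ℝ) (k : ℕ)
    (d : ℝ) : Prop where
  iter : ∀ z ∈ Ico x y, (trans p q lam)^[k] z = z + d
  phase : ∃ c : ℂ, ‖c‖ = 1 ∧ ∀ᵐ z ∂(volume : Measure ℝ), z ∈ Ico x y → f (z + d) = c * f z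

lemma Carries.zero (x y : ℝ) : Carries p q lam f x y 0 0 :=
  ⟨fun z _ => by simp, 1, by simp, Filter.Eventually.of_forall fun z _ => by simp⟩

lemma Carries.bounds {x y d : ℝ} {k : ℕ} (hc : Carries p q lam f x y k d)
    (hl : ∀ a, 0 ≤ lam a) (h0 : 0 ≤ x) (hxy : x < y) (hy : y ≤ ∑ b, lam b) :
    0 ≤ x + d ∧ y + d ≤ ∑ b, lam b := by
  have h1 : ∀ z ∈ Ico x y, z + d ∈ Ico 0 (∑ b, lam b) := by
    intro z hz
    rw [← hc.iter z hz]
    exact iterate_trans_mem hl ⟨h0.trans hz.1, hz.2.trans_le hy⟩ k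
  refine ⟨(h1 x ⟨le_rfl, hxy⟩).1, ?_⟩
  by_contra hcon
  have h2 := (h1 x ⟨le_rfl, hxy⟩).2
  have h3 := h1 ((∑ b, lam b) - d) ⟨by linarith, by linarith⟩
  linarith [h3.2]

lemma exists_blk_of_no_disc {x y : ℝ} (h0 : 0 ≤ x) (hxy : x < y)
    (hy : y ≤ ∑ b, lam b) (hno : ∀ a, (p a : ℕ) ≠ 0 → ¬ (x < off p a lam ∧ off p a lam < y)) :
    ∃ a, Ico x y ⊆ blk p lam a := by
  obtain ⟨a, ha⟩ := exists_mem_blk (p := p) (lam := lam) (x := x) ⟨h0, hxy.trans_le hy⟩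
  refine ⟨a, fun z hz => ⟨ha.1.trans hz.1, ?_⟩⟩
  by_contra hcon
  rw [not_lt] at hcon
  have hlast : (p a : ℕ) + 1 ≠ m := by
    intro h
    rw [off_add_eq_sum h] at hcon
    linarith [hz.2]
  have hlt : (p a : ℕ) + 1 < m := by have := (p a).2; omega
  have h1 : off p (p.symm ⟨p a + 1, hlt⟩) lam = off p a lam + lam a := off_add_eq_off (by simp)
  refine hno (p.symm ⟨p a + 1, hlt⟩) (by simp) ?_
  rw [h1]
  exact ⟨ha.2, hcon.trans_lt hz.2⟩

lemma Carries.succ {x y d : ℝ} {k : ℕ} (hc : Carries p q lam f x y k d)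
    (hf : Solves p q lam e f) (he : ∀ a, ‖e a‖ = 1)
    (hl : ∀ a, 0 ≤ lam a) (h0 : 0 ≤ x) (hxy : x < y) (hy : y ≤ ∑ b, lam b)
    (hno : ∀ a, (p a : ℕ) ≠ 0 → ¬ (x + d < off p a lam ∧ off p a lam < y + d)) :
    ∃ d', Carries p q lam f x y (k + 1) d' := by
  obtain ⟨hb1, hb2⟩ := hc.bounds hl h0 hxy hy
  obtain ⟨a, ha⟩ := exists_blk_of_no_disc hb1 (by linarith) hb2 hno
  have hmem : ∀ z ∈ Ico x y, z + d ∈ blk p lam a := fun z hz =>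
    ha ⟨by linarith [hz.1], by linarith [hz.2]⟩
  refine ⟨d + wv p q a lam, fun z hz => ?_, ?_⟩
  · rw [Function.iterate_succ_apply', hc.iter z hz, trans_of_mem hl (hmem z hz), add_assoc]
  · obtain ⟨c, hc1, hc2⟩ := hc.phase
    refine ⟨e a * c, by rw [norm_mul, he, hc1, one_mul], ?_⟩
    filter_upwards [hc2, ae_add_right (hf a) d] with z h1 h2 hz
    rw [← add_assoc, h2 (hmem z hz), h1 hz, mul_assoc]

/-- Every interval is carried by some iterate across a discontinuity. -/
lemma exists_carries_disc (hf : Solves p q lam e f) (he : ∀ a, ‖e a‖ = 1)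
    (hg : Generic p q lam) (hl : ∀ a, 0 < lam a) {x y : ℝ} (h0 : 0 ≤ x) (hxy : x < y)
    (hy : y ≤ ∑ b, lam b) :
    ∃ k d a, Carries p q lam f x y k d ∧ (p a : ℕ) ≠ 0 ∧
      x + d < off p a lam ∧ off p a lam < y + d := by
  have hl0 : ∀ a, 0 ≤ lam a := fun a => (hl a).le
  by_contra! hcon
  have hall : ∀ k, ∃ d, Carries p q lam f x y k d := by
    intro k
    induction k with
    | zero => exact ⟨0, Carries.zero x y⟩
    | succ k ih =>
      obtain ⟨d, hd⟩ := ih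
      exact hd.succ hf he hl0 h0 hxy hy fun a ha h => absurd h.2 (not_lt.2 (hcon k d a hd ha h.1))
  choose d hd using hall
  obtain ⟨z, hz, k, hk, hzk⟩ := exists_return (p := p) (q := q) hl0 h0 hxy hy
  have hzk' := (hd k).iter z hz
  have hmul : ∀ j : ℕ, d (k * j) = j * d k := by
    intro j
    induction j with
    | zero =>
      have := (hd (k * 0)).iter z hz
      simp only [mul_zero, Function.iterate_zero, id_eq] at this
      simp only [mul_zero, Nat.cast_zero, zero_mul]
      linarith
    | succ j ih =>
      have h1 := (hd (k * (j + 1))).iter z hz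
      rw [mul_add, mul_one, Function.iterate_add_apply, (hd (k * j)).iter _ hzk, hzk', ih] at h1
      rw [mul_add, mul_one]
      push_cast
      linarith
  have hbound : ∀ j : ℕ, |(j : ℝ) * d k| ≤ ∑ b, lam b := by
    intro j
    have h1 := (hd (k * j)).bounds hl0 h0 hxy hy
    rw [hmul] at h1
    rw [abs_le]
    constructor <;> linarith [h1.1, h1.2]
  have hdk : d k = 0 := by
    by_contra hne
    obtain ⟨j, hj⟩ := exists_nat_gt ((∑ b, lam b) / |d k|)
    rw [div_lt_iff₀ (abs_pos.2 hne)] at hj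
    have := hbound j
    rw [abs_mul, Nat.abs_cast] at this
    linarith
  obtain ⟨N, hN, hNz⟩ := exists_iterate_eq (p := p) (q := q) hl0
    (x := z) ⟨h0.trans hz.1, hz.2.trans_le hy⟩ k
  refine hg.sum_ne N ?_ ?_
  · rintro rfl
    simp at hN
    exact hk hN.symm
  · rw [hzk', hdk] at hNz
    linarith

end carry

section near

variable {p q : Equiv.Perm (Fin m)} {lam : Fin m → ℝ} {e : Fin m → ℂ} {f : ℝ → ℂ}

/-- `f` is within `δ` of a constant on `[x, y]`, in the mean. -/
def Near (f : ℝ → ℂ) (x y δ : ℝ) : Prop := ∃ c : ℂ, ∫ z in x..y, ‖f z - c‖ ≤ δ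

lemma intervalIntegrable_of_bounded {E : Type*} [NormedAddCommGroup E] {g : ℝ → E}
    (hg : AEStronglyMeasurable g volume) {C : ℝ} (hC : ∀ z, ‖g z‖ ≤ C) (x y : ℝ) :
    IntervalIntegrable g volume x y := by
  have h := (intervalIntegrable_const (c := C) (μ := volume) (a := x) (b := y))
  exact h.mono_fun hg.restrict (Filter.Eventually.of_forall fun z =>
    (hC z).trans (le_abs_self C))

lemma intervalIntegrable_norm_sub (hfm : Measurable f) (hf1 : ∀ z, ‖f z‖ ≤ 1) (c : ℂ)
    (x y : ℝ) : IntervalIntegrable (fun z => ‖f z - c‖) volume x y := by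
  refine intervalIntegrable_of_bounded
    (hfm.sub_const c).norm.aestronglyMeasurable (C := 1 + ‖c‖) (fun z => ?_) x y
  rw [norm_norm]
  exact (norm_sub_le _ _).trans (by linarith [hf1 z])

lemma Near.mono (hfm : Measurable f) (hf1 : ∀ z, ‖f z‖ ≤ 1) {x y x' y' δ δ' : ℝ}
    (h : Near f x y δ) (hx : x ≤ x') (hxy : x' ≤ y') (hy : y' ≤ y) (hδ : δ ≤ δ') :
    Near f x' y' δ' := by
  obtain ⟨c, hc⟩ := h
  refine ⟨c, le_trans ?_ (hc.trans hδ)⟩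
  exact intervalIntegral.integral_mono_interval hx hxy hy
    (Filter.Eventually.of_forall fun z => norm_nonneg _)
    (intervalIntegrable_norm_sub hfm hf1 c x y)

lemma Carries.near {x y d δ : ℝ} {k : ℕ} (hc : Carries p q lam f x y k d) (hxy : x ≤ y)
    (h : Near f (x + d) (y + d) δ) : Near f x y δ := by
  obtain ⟨c, hc1, hc2⟩ := hc.phase
  obtain ⟨c', hc'⟩ := h
  have hc0 : c ≠ 0 := fun h0 => by simp [h0] at hc1
  refine ⟨c⁻¹ * c', le_of_eq_of_le ?_ hc'⟩
  rw [← intervalIntegral.integral_comp_add_right (fun z => ‖f z - c'‖) d,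
    intervalIntegral.integral_of_le hxy, intervalIntegral.integral_of_le hxy,
    ← integral_Ico_eq_integral_Ioc, ← integral_Ico_eq_integral_Ioc]
  refine setIntegral_congr_ae measurableSet_Ico ?_
  filter_upwards [hc2] with z hz hmem
  rw [hz hmem]
  calc ‖f z - c⁻¹ * c'‖ = ‖c‖ * ‖f z - c⁻¹ * c'‖ := by rw [hc1, one_mul]
    _ = ‖c * (f z - c⁻¹ * c')‖ := (norm_mul _ _).symm
    _ = ‖c * f z - c'‖ := by rw [mul_sub, mul_inv_cancel_left₀ hc0]

/-- Among `n` disjoint intervals there is one on which a given integrable function has integral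
at most `1 / n` of the total. -/
lemma exists_small_integral {φ : ℝ → ℝ} (hφ : Integrable φ) (h0 : ∀ z, 0 ≤ φ z) {n : ℕ}
    (hn : 0 < n) {ρ : ℝ} (hρ : 0 ≤ ρ) (x : Fin n → ℝ) (hx : ∀ i j, i ≠ j → ρ ≤ |x i - x j|) :
    ∃ i, ∫ z in x i..x i + ρ, φ z ≤ (∫ z, φ z) / n := by
  have hdisj : Pairwise (Function.onFun Disjoint fun i => Ioc (x i) (x i + ρ)) := by
    intro i j hij
    refine Set.disjoint_left.2 fun z hz hz' => ?_
    have := hx i j hij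
    rcases le_abs.1 this with h | h <;> linarith [hz.1, hz.2, hz'.1, hz'.2]
  have hsum : ∑ i, ∫ z in x i..x i + ρ, φ z ≤ ∫ z, φ z := by
    have h1 : ∀ i, ∫ z in x i..x i + ρ, φ z = ∫ z in Ioc (x i) (x i + ρ), φ z := fun i =>
      intervalIntegral.integral_of_le (by linarith)
    simp only [h1]
    rw [← integral_iUnion_fintype (fun i => measurableSet_Ioc) hdisj fun i => hφ.integrableOn]
    exact setIntegral_le_integral hφ (Filter.Eventually.of_forall h0)
  have hne : (Finset.univ : Finset (Fin n)).Nonempty := ⟨⟨0, hn⟩, Finset.mem_univ _⟩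
  obtain ⟨i, -, hi⟩ := Finset.exists_le_of_sum_le (s := Finset.univ)
    (f := fun i => ∫ z in x i..x i + ρ, φ z) (g := fun _ => (∫ z, φ z) / n) hne (by
      rw [Finset.sum_const, Finset.card_univ, Fintype.card_fin, nsmul_eq_mul,
        mul_div_cancel₀ _ (Nat.cast_ne_zero.2 hn.ne')]
      exact hsum)
  exact ⟨i, hi⟩

/-- Good separation of backward orbits of discontinuities yields that a solution is nearly
constant around each discontinuity. -/
lemma near_of_good (hfm : Measurable f) (hf1 : ∀ z, ‖f z‖ ≤ 1) (hfi : Integrable f)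
    (hf : Solves p q lam e f) (he : ∀ a, ‖e a‖ = 1) (hl : ∀ a, 0 < lam a)
    {s : ℝ} (hs : 0 < s) {ε : ℝ} (hε : 0 < ε) :
    ∃ R > 0, ∀ n : ℕ, 0 < n → s / n < R → Good q p n (s / n) lam → ∀ b, (p b : ℕ) ≠ 0 →
      Near f (off p b lam - s / n / 2) (off p b lam + s / n / 2) (ε * (s / n)) := by
  have hl0 : ∀ a, 0 ≤ lam a := fun a => (hl a).le
  set ε' := ε / (1 / s + 1) with hε'
  have hε'0 : 0 < ε' := by positivity
  obtain ⟨g, hgs, hgf, hgc, hgi⟩ := hfi.exists_hasCompactSupport_integral_sub_le hε'0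
  have huc := hgs.uniformContinuous_of_continuous hgc
  obtain ⟨R, hR, hgR⟩ := Metric.uniformContinuous_iff.1 huc ε' hε'0
  refine ⟨R, hR, fun n hn hnR hgood b hb => ?_⟩
  set ρ := s / n with hρdef
  have hn0 : (0 : ℝ) < n := by exact_mod_cast hn
  have hρ : 0 < ρ := by positivity
  set x := off p b lam - ρ / 2 with hx
  set y := off p b lam + ρ / 2 with hy
  have hxy : x < y := by rw [hx, hy]; linarith
  set P : Fin n → ℝ := fun k => pt q p lam (.inr (⟨b, hb⟩, k)) with hP
  have hP0 : P ⟨0, hn⟩ = off p b lam := rfl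
  have hx0 : 0 ≤ x := by
    set a₀ : Fin m := q.symm ⟨0, by have := b.2; omega⟩ with ha₀
    have h1 := hgood.1 (.inr (⟨b, hb⟩, ⟨0, hn⟩)) (.inl a₀) (by simp)
    have h2 : pt q p lam (n := n) (.inl a₀) = 0 := off_eq_zero (by simp [ha₀])
    rw [h2, sub_zero, abs_of_nonneg (pt_mem hl _).1] at h1
    have h3 : ρ ≤ off p b lam := h1
    rw [hx]
    linarith
  have hyS : y ≤ ∑ c, lam c := by
    have h1 := hgood.2 (.inr (⟨b, hb⟩, ⟨0, hn⟩))
    have h2 : off p b lam + ρ ≤ ∑ c, lam c := h1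
    rw [hy]
    linarith
  have hsol := hf.swap he
  have he' : ∀ a, ‖(e a)⁻¹‖ = 1 := fun a => by rw [norm_inv, he, inv_one]
  have hcar : ∀ k, ∀ hk : k < n, ∃ d, Carries q p lam f x y k d := by
    intro k
    induction k with
    | zero => exact fun _ => ⟨0, Carries.zero x y⟩
    | succ k ih =>
      intro hk
      obtain ⟨d, hd⟩ := ih (by omega)
      refine hd.succ hsol he' hl0 hx0 hxy hyS fun a _ hlt => ?_
      have h1 := hgood.1 (.inr (⟨b, hb⟩, ⟨k, by omega⟩)) (.inl a) (by simp)
      have h2 : pt q p lam (.inr (⟨b, hb⟩, (⟨k, by omega⟩ : Fin n))) = off p b lam + d :=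
        hd.iter _ ⟨by linarith, by linarith⟩
      have h3 : pt q p lam (n := n) (.inl a) = off q a lam := rfl
      rw [h2, h3] at h1
      rcases le_abs.1 h1 with h | h <;> linarith [hlt.1, hlt.2]
  have hfg : Integrable (fun z => ‖f z - g z‖) := (hfi.sub hgi).norm
  obtain ⟨k, hk⟩ := exists_small_integral hfg (fun z => norm_nonneg _) hn hρ.le
    (fun k => P k - ρ / 2) (fun i j hij => by
      have := hgood.1 (.inr (⟨b, hb⟩, i)) (.inr (⟨b, hb⟩, j)) (by simpa using hij)
      simpa [hP] using this)
  obtain ⟨d, hd⟩ := hcar k k.2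
  have hPk : P k = off p b lam + d := hd.iter _ ⟨by linarith, by linarith⟩
  refine hd.near hxy.le ⟨g (P k), ?_⟩
  have e1 : x + d = P k - ρ / 2 := by rw [hPk, hx]; ring
  have e2 : y + d = P k - ρ / 2 + ρ := by rw [hPk, hy]; ring
  rw [e1, e2]
  have hle : P k - ρ / 2 ≤ P k - ρ / 2 + ρ := by linarith
  calc ∫ z in P k - ρ / 2..P k - ρ / 2 + ρ, ‖f z - g (P k)‖
      ≤ ∫ z in P k - ρ / 2..P k - ρ / 2 + ρ, (‖f z - g z‖ + ε') := by
        refine intervalIntegral.integral_mono_on hle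
          (intervalIntegrable_norm_sub hfm hf1 _ _ _)
          (hfg.intervalIntegrable.add intervalIntegrable_const) fun z hz => ?_
        have h1 : ‖g z - g (P k)‖ < ε' := by
          rw [← dist_eq_norm]
          refine hgR ?_
          rw [Real.dist_eq]
          refine lt_of_le_of_lt ?_ hnR
          rw [abs_le]
          constructor <;> linarith [hz.1, hz.2]
        calc ‖f z - g (P k)‖ = ‖(f z - g z) + (g z - g (P k))‖ := by ring_nf
          _ ≤ ‖f z - g z‖ + ‖g z - g (P k)‖ := norm_add_le _ _
          _ ≤ _ := by linarith
    _ = (∫ z in P k - ρ / 2..P k - ρ / 2 + ρ, ‖f z - g z‖) + ρ * ε' := by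
        rw [intervalIntegral.integral_add hfg.intervalIntegrable intervalIntegrable_const,
          intervalIntegral.integral_const]
        simp
    _ ≤ ε' / n + ρ * ε' := by
        gcongr
        exact hk.trans (by gcongr)
    _ = ε * ρ := by
        rw [hε', hρdef]
        field_simp

/-- Near constancy on all intervals of a suitable scale. -/
lemma exists_scale (hfm : Measurable f) (hf1 : ∀ z, ‖f z‖ ≤ 1) (hfi : Integrable f)
    (hf : Solves p q lam e f) (he : ∀ a, ‖e a‖ = 1) (hl : ∀ a, 0 < lam a)
    (hg : Generic p q lam) {s : ℝ} (hs : 0 < s)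
    (hgood : ∃ᶠ n : ℕ in Filter.atTop, Good q p n (s / n) lam) {ε r₀ : ℝ} (hε : 0 < ε)
    (hr₀ : 0 < r₀) :
    ∃ r > 0, r < r₀ ∧ ∀ x, 0 ≤ x → x + 2 * r ≤ ∑ b, lam b → Near f x (x + 2 * r) (ε * r) := by
  obtain ⟨R, hR, hnear⟩ := near_of_good hfm hf1 hfi hf he hl hs (show 0 < ε / 4 by positivity)
  have hlim : Filter.Tendsto (fun n : ℕ => s / (n : ℝ)) Filter.atTop (nhds 0) :=
    tendsto_const_div_atTop_nhds_zero_nat s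
  have hev := (hlim.eventually_lt_const (lt_min hR hr₀)).and (Filter.eventually_gt_atTop 0)
  obtain ⟨n, hn, hnR, hn0⟩ := (hgood.and_eventually hev).exists
  have hn1 : (0 : ℝ) < n := by exact_mod_cast hn0
  set ρ := s / n with hρ
  have hρ0 : 0 < ρ := by positivity
  refine ⟨ρ / 4, by positivity, ?_, fun x hx hxS => ?_⟩
  · linarith [hnR.trans_le (min_le_right R r₀)]
  · obtain ⟨k, d, a, hc, ha, h1, h2⟩ :=
      exists_carries_disc hf he hg hl hx (show x < x + 2 * (ρ / 4) by linarith) hxS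
    refine hc.near (by linarith) ?_
    have := hnear n hn0 (hnR.trans_le (min_le_left R r₀)) hn a ha
    exact this.mono hfm hf1 (by linarith) (by linarith) (by linarith) (by linarith)

end near

section average

variable {p q : Equiv.Perm (Fin m)} {lam : Fin m → ℝ} {e : Fin m → ℂ} {f : ℝ → ℂ}

/-- The average of `f` over `[x, x + r]`. -/
def avg (f : ℝ → ℂ) (r x : ℝ) : ℂ := (r : ℂ)⁻¹ * ∫ z in x..x + r, f z

lemma norm_avg_sub_le (hfm : Measurable f) (hf1 : ∀ z, ‖f z‖ ≤ 1) {r : ℝ} (hr : 0 < r)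
    (c : ℂ) (x : ℝ) : ‖avg f r x - c‖ ≤ r⁻¹ * ∫ z in x..x + r, ‖f z - c‖ := by
  have hr' : (r : ℂ) ≠ 0 := by exact_mod_cast hr.ne'
  have hfint : IntervalIntegrable f volume x (x + r) :=
    intervalIntegrable_of_bounded hfm.aestronglyMeasurable hf1 _ _
  have h1 : avg f r x - c = (r : ℂ)⁻¹ * ∫ z in x..x + r, (f z - c) := by
    rw [intervalIntegral.integral_sub hfint intervalIntegrable_const,
      intervalIntegral.integral_const, avg, add_sub_cancel_left, mul_sub, Complex.real_smul,
      inv_mul_cancel_left₀ hr']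
  rw [h1, norm_mul, norm_inv, Complex.norm_real, Real.norm_of_nonneg hr.le]
  gcongr
  exact intervalIntegral.norm_integral_le_integral_norm (by linarith)

lemma norm_avg_le (hfm : Measurable f) (hf1 : ∀ z, ‖f z‖ ≤ 1) {r : ℝ} (hr : 0 < r)
    (x : ℝ) : ‖avg f r x‖ ≤ 1 := by
  have h := norm_avg_sub_le hfm hf1 hr 0 x
  simp only [sub_zero] at h
  refine h.trans ?_
  have h2 : ∫ z in x..x + r, ‖f z‖ ≤ ∫ z in x..x + r, (1 : ℝ) :=
    intervalIntegral.integral_mono_on (by linarith)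
      (by simpa using intervalIntegrable_norm_sub hfm hf1 0 x (x + r))
      intervalIntegrable_const fun z _ => hf1 z
  rw [intervalIntegral.integral_const, add_sub_cancel_left, smul_eq_mul, mul_one] at h2
  rw [inv_mul_le_iff₀ hr]
  linarith

lemma continuous_avg (hfm : Measurable f) (hf1 : ∀ z, ‖f z‖ ≤ 1) (r : ℝ) :
    Continuous (avg f r) := by
  have hfint : ∀ x y, IntervalIntegrable f volume x y := fun x y =>
    intervalIntegrable_of_bounded hfm.aestronglyMeasurable hf1 _ _
  have h := intervalIntegral.continuous_primitive hfint 0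
  have h1 : avg f r =
      fun x => (r : ℂ)⁻¹ * ((∫ z in (0 : ℝ)..x + r, f z) - ∫ z in (0 : ℝ)..x, f z) := by
    funext x
    rw [avg, intervalIntegral.integral_interval_sub_left (hfint _ _) (hfint _ _)]
  rw [h1]
  exact continuous_const.mul ((h.comp (continuous_id.add continuous_const)).sub h)

lemma avg_solves (hf : Solves p q lam e f) (a : Fin m) {r x : ℝ} (hr : 0 < r)
    (hx : off p a lam ≤ x) (hxr : x + r ≤ off p a lam + lam a) :
    avg f r (x + wv p q a lam) = e a * avg f r x := by
  rw [avg, avg, show x + wv p q a lam + r = x + r + wv p q a lam by ring,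
    ← intervalIntegral.integral_comp_add_right, mul_left_comm (e a)]
  congr 1
  rw [← intervalIntegral.integral_const_mul]
  have hle : x ≤ x + r := by linarith
  rw [intervalIntegral.integral_of_le hle, intervalIntegral.integral_of_le hle,
    ← integral_Ico_eq_integral_Ioc, ← integral_Ico_eq_integral_Ioc]
  refine setIntegral_congr_ae measurableSet_Ico ?_
  filter_upwards [hf a] with z hz hmem
  exact hz ⟨hx.trans hmem.1, hmem.2.trans_le hxr⟩

lemma Near.avg_close (hfm : Measurable f) (hf1 : ∀ z, ‖f z‖ ≤ 1) {r x ε : ℝ} {c : ℂ} (hr : 0 < r)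
    (hc : ∫ z in x..x + 2 * r, ‖f z - c‖ ≤ ε * r) {y : ℝ} (hxy : x ≤ y) (hyx : y ≤ x + r) :
    ‖avg f r y - c‖ ≤ ε := by
  refine (norm_avg_sub_le hfm hf1 hr c y).trans ?_
  rw [inv_mul_le_iff₀ hr, mul_comm r]
  refine le_trans ?_ hc
  exact intervalIntegral.integral_mono_interval hxy (by linarith) (by linarith)
    (Filter.Eventually.of_forall fun z => norm_nonneg _)
    (intervalIntegrable_norm_sub hfm hf1 c x _)

lemma const_dichotomy (hfm : Measurable f) (hf01 : ∀ z, ‖f z‖ = 0 ∨ ‖f z‖ = 1) {r x ε : ℝ} {c : ℂ}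
    (hr : 0 < r) (hε : 0 < ε) (hc : ∫ z in x..x + 2 * r, ‖f z - c‖ ≤ ε * r) :
    ‖c‖ ≤ ε ∨ 1 - ε ≤ ‖c‖ := by
  by_contra! hcon
  have hf1 : ∀ z, ‖f z‖ ≤ 1 := fun z => by rcases hf01 z with h | h <;> simp [h]
  have h2 : ∫ z in x..x + 2 * r, ε ≤ ∫ z in x..x + 2 * r, ‖f z - c‖ := by
    refine intervalIntegral.integral_mono_on (by linarith) intervalIntegrable_const
      (intervalIntegrable_norm_sub hfm hf1 c x _) fun z _ => ?_
    have h3 := abs_norm_sub_norm_le (f z) c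
    rcases hf01 z with h | h <;> rw [h] at h3
    · have := neg_abs_le (0 - ‖c‖)
      linarith
    · have := le_abs_self (1 - ‖c‖)
      linarith
  rw [intervalIntegral.integral_const, add_sub_cancel_left, smul_eq_mul] at h2
  have := mul_pos hε hr
  linarith

/-- Near a density point of its support the averages of `f` are large. -/
lemma exists_avg_gt (hf01 : ∀ z, ‖f z‖ = 0 ∨ ‖f z‖ = 1)
    (hfi : Integrable f) {L : ℝ} (hpos : 0 < volume {x ∈ Ico (0 : ℝ) L | f x ≠ 0}) :
    ∃ x, 0 ≤ x ∧ x < L ∧ ∃ r₀ > 0, ∀ r, 0 < r → r < r₀ → 1 / 2 < ‖avg f r x‖ := by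
  obtain ⟨x, hx, hd⟩ : ∃ x ∈ {x ∈ Ico (0 : ℝ) L | f x ≠ 0},
      ∀ c, HasDerivAt (fun x => ∫ t in c..x, f t) (f x) x := by
    by_contra! hcon
    refine hpos.ne' (measure_mono_null ?_ (ae_iff.1
      (LocallyIntegrable.ae_hasDerivAt_integral hfi.locallyIntegrable)))
    intro x hx hall
    obtain ⟨c, hc⟩ := hcon x hx
    exact hc (hall c)
  have hn : ‖f x‖ = 1 := (hf01 x).resolve_left (norm_ne_zero_iff.2 hx.2)
  refine ⟨x, hx.1.1, hx.1.2, ?_⟩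
  have h1 := (hd x).tendsto_slope_zero_right
  have h2 := (h1.norm.eventually_const_lt (u := 1 / 2) (by rw [hn]; norm_num))
  obtain ⟨r₀, hr₀, hsub⟩ := mem_nhdsGT_iff_exists_Ioo_subset.1 h2
  refine ⟨r₀, hr₀, fun r hr hrr => ?_⟩
  have h3 := hsub ⟨hr, hrr⟩
  simpa [avg] using h3

end average

section limit

variable {p q : Equiv.Perm (Fin m)} {lam : Fin m → ℝ} {e : Fin m → ℂ} {f : ℝ → ℂ}

/-- Approximate matching conditions for the boundary values `U.1 a`, `U.2 a` of a solution at
the left and right end of the interval of `a`. -/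
def Compat (p q : Equiv.Perm (Fin m)) (e : Fin m → ℂ) (ε : ℝ)
    (U : (Fin m → ℂ) × (Fin m → ℂ)) : Prop :=
  (∀ a, 1 - ε ≤ ‖U.1 a‖ ∧ ‖U.1 a‖ ≤ 1 ∧ 1 - ε ≤ ‖U.2 a‖ ∧ ‖U.2 a‖ ≤ 1) ∧
  (∀ a b, (p b : ℕ) = p a + 1 → ‖U.1 b - U.2 a‖ ≤ ε) ∧
  (∀ a b, (q b : ℕ) = q a + 1 → ‖e b * U.1 b - e a * U.2 a‖ ≤ ε) ∧
  (∀ a b, (p a : ℕ) = 0 → (q b : ℕ) = 0 → ‖U.1 a - e b * U.1 b‖ ≤ ε) ∧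
  (∀ a b, (p a : ℕ) + 1 = m → (q b : ℕ) + 1 = m → ‖U.2 a - e b * U.2 b‖ ≤ ε)

lemma Compat.mono {ε ε' : ℝ} {U} (h : Compat p q e ε U) (hε : ε ≤ ε') : Compat p q e ε' U :=
  ⟨fun a => ⟨by linarith [(h.1 a).1], (h.1 a).2.1, by linarith [(h.1 a).2.2.1], (h.1 a).2.2.2⟩,
    fun a b h1 => (h.2.1 a b h1).trans hε, fun a b h1 => (h.2.2.1 a b h1).trans hε,
    fun a b h1 h2 => (h.2.2.2.1 a b h1 h2).trans hε,
    fun a b h1 h2 => (h.2.2.2.2 a b h1 h2).trans hε⟩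

lemma isClosed_compat (ε : ℝ) : IsClosed {U | Compat p q e ε U} := by
  simp only [Compat, ofPred_and, ofPred_forall]
  refine IsClosed.inter ?_ (IsClosed.inter ?_ (IsClosed.inter ?_ (IsClosed.inter ?_ ?_)))
  · refine isClosed_iInter fun a => ?_
    refine IsClosed.inter ?_ (IsClosed.inter ?_ (IsClosed.inter ?_ ?_)) <;>
      exact isClosed_le (by fun_prop) (by fun_prop)
  all_goals
    repeat' refine isClosed_iInter fun _ => ?_
    exact isClosed_le (by fun_prop) (by fun_prop)

lemma exists_compat_zero (h : ∀ ε > 0, ∃ U, Compat p q e ε U) : ∃ U, Compat p q e 0 U := by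
  have hne := IsCompact.nonempty_iInter_of_sequence_nonempty_isCompact_isClosed
    (fun n : ℕ => {U | Compat p q e (1 / ((n : ℝ) + 1)) U})
    (fun n U hU => Compat.mono hU (by push_cast; gcongr; linarith))
    (fun n => h _ (by positivity)) ?_ (fun n => isClosed_compat _)
  · obtain ⟨U, hU⟩ := hne
    rw [mem_iInter] at hU
    refine ⟨U, ?_⟩
    have hlim : Filter.Tendsto (fun n : ℕ => 1 / ((n : ℝ) + 1)) Filter.atTop (nhds 0) :=
      tendsto_one_div_add_atTop_nhds_zero_nat
    have hle : ∀ x : ℝ, (∀ n : ℕ, x ≤ 1 / ((n : ℝ) + 1)) → x ≤ 0 := fun x hx =>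
      ge_of_tendsto' hlim hx
    refine ⟨fun a => ⟨?_, ((hU 0).1 a).2.1, ?_, ((hU 0).1 a).2.2.2⟩,
      fun a b h1 => hle _ fun n => (hU n).2.1 a b h1,
      fun a b h1 => hle _ fun n => (hU n).2.2.1 a b h1,
      fun a b h1 h2 => hle _ fun n => (hU n).2.2.2.1 a b h1 h2,
      fun a b h1 h2 => hle _ fun n => (hU n).2.2.2.2 a b h1 h2⟩
    · have := hle (1 - ‖U.1 a‖) fun n => by linarith [((hU n).1 a).1]
      linarith
    · have := hle (1 - ‖U.2 a‖) fun n => by linarith [((hU n).1 a).2.2.1]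
      linarith
  · refine (isCompact_closedBall (0 : (Fin m → ℂ) × (Fin m → ℂ)) 1).of_isClosed_subset
      (isClosed_compat _) fun U hU => ?_
    rw [mem_closedBall_zero_iff, Prod.norm_def, max_le_iff, pi_norm_le_iff_of_nonneg zero_le_one,
      pi_norm_le_iff_of_nonneg zero_le_one]
    exact ⟨fun a => (hU.1 a).2.1, fun a => (hU.1 a).2.2.2⟩

/-- The averages of a solution over short intervals at the ends of the exchanged intervals
satisfy the matching conditions approximately. -/
lemma exists_compat (hfm : Measurable f) (hf01 : ∀ z, ‖f z‖ = 0 ∨ ‖f z‖ = 1)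
    (hfi : Integrable f) (hpos : 0 < volume {x ∈ Ico (0 : ℝ) (∑ b, lam b) | f x ≠ 0})
    (hf : Solves p q lam e f) (he : ∀ a, ‖e a‖ = 1) (hl : ∀ a, 0 < lam a)
    (hg : Generic p q lam) {s : ℝ} (hs : 0 < s)
    (hgood : ∃ᶠ n : ℕ in Filter.atTop, Good q p n (s / n) lam) {ε : ℝ} (hε : 0 < ε) :
    ∃ U, Compat p q e ε U := by
  have hf1 : ∀ z, ‖f z‖ ≤ 1 := fun z => by rcases hf01 z with h | h <;> simp [h]
  wlog hε1 : ε ≤ 1 / 4 generalizing ε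
  · obtain ⟨U, hU⟩ := this (ε := 1 / 4) (by norm_num) le_rfl
    exact ⟨U, hU.mono (by linarith)⟩
  have hl0 : ∀ a, 0 ≤ lam a := fun a => (hl a).le
  obtain ⟨x₀, hx₀, hx₀L, r₀, hr₀, hbig⟩ := exists_avg_gt hf01 hfi hpos
  set L := ∑ b, lam b with hL
  obtain ⟨r₁, hr₁, hr₁l⟩ : ∃ r₁ > 0, ∀ a, r₁ ≤ lam a := by
    rcases isEmpty_or_nonempty (Fin m) with hE | hE
    · exact ⟨1, one_pos, fun a => hE.elim a⟩
    · obtain ⟨a, ha⟩ := Finite.exists_min lam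
      exact ⟨lam a, hl a, ha⟩
  obtain ⟨r, hr, hrmin, hnear⟩ := exists_scale hfm hf1 hfi hf he hl hg hs hgood
    (show 0 < ε / 2 by positivity)
    (show 0 < min (min r₀ r₁) (min (L - x₀) (L / 2)) by
      have : 0 < L - x₀ := by linarith
      have : 0 < L / 2 := by linarith
      positivity)
  simp only [lt_min_iff] at hrmin
  obtain ⟨⟨hrr₀, hrr₁⟩, hrx, hrL⟩ := hrmin
  have hdich : ∀ y ∈ Icc 0 (L - r), ‖avg f r y‖ ≤ ε ∨ 1 - ε ≤ ‖avg f r y‖ := by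
    intro y hy
    obtain ⟨x, hx, hxL, hxy, hyx⟩ : ∃ x, 0 ≤ x ∧ x + 2 * r ≤ L ∧ x ≤ y ∧ y ≤ x + r := by
      rcases le_total (y + 2 * r) L with h | h
      · exact ⟨y, hy.1, h, le_rfl, by linarith⟩
      · exact ⟨L - 2 * r, by linarith, by linarith, by linarith, by linarith [hy.2]⟩
    obtain ⟨c, hc⟩ := hnear x hx hxL
    have h1 := Near.avg_close hfm hf1 hr hc hxy hyx
    have h2 := abs_norm_sub_norm_le (avg f r y) c
    have h3 := abs_le.1 (h2.trans h1)
    rcases const_dichotomy hfm hf01 hr (by positivity) hc with h | h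
    · left; linarith [h3.2]
    · right; linarith [h3.1]
  have hlarge : ∀ y ∈ Icc 0 (L - r), 1 - ε ≤ ‖avg f r y‖ := by
    intro y hy
    by_contra hcon
    have h1 := (hdich y hy).resolve_right hcon
    have h2 := hbig r hr hrr₀
    obtain ⟨z, hz, hz2⟩ := isPreconnected_Icc.intermediate_value hy
      (show x₀ ∈ Icc 0 (L - r) from ⟨hx₀, by linarith⟩)
      (continuous_avg hfm hf1 r).norm.continuousOn
      (show (1 / 2 : ℝ) ∈ Icc _ _ from ⟨by linarith, h2.le⟩)
    simp only at hz2
    rcases hdich z hz with h | h <;> linarith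
  have hadj : ∀ y, r ≤ y → y + r ≤ L → ‖avg f r y - avg f r (y - r)‖ ≤ ε := by
    intro y hy hyL
    obtain ⟨c, hc⟩ := hnear (y - r) (by linarith) (by linarith)
    have h1 := Near.avg_close hfm hf1 hr hc (y := y) (by linarith) (by linarith)
    have h2 := Near.avg_close hfm hf1 hr hc (y := y - r) (by linarith) (by linarith)
    calc ‖avg f r y - avg f r (y - r)‖
        = ‖(avg f r y - c) - (avg f r (y - r) - c)‖ := by ring_nf
      _ ≤ ε / 2 + ε / 2 := (norm_sub_le _ _).trans (add_le_add h1 h2)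
      _ = ε := by ring
  have hrl : ∀ a, r ≤ lam a := fun a => hrr₁.le.trans (hr₁l a)
  have hU : ∀ a, avg f r (off q a lam) = e a * avg f r (off p a lam) := by
    intro a
    rw [← avg_solves hf a hr le_rfl (by linarith [hrl a])]
    congr 1
    simp [wv]
  have hU' : ∀ a, avg f r (off q a lam + lam a - r) =
      e a * avg f r (off p a lam + lam a - r) := by
    intro a
    rw [← avg_solves hf a hr (by linarith [hrl a]) (by linarith)]
    congr 1
    simp only [wv, LinearMap.sub_apply]
    ring
  have hoff : ∀ (p : Equiv.Perm (Fin m)) a, 0 ≤ off p a lam ∧ off p a lam + lam a ≤ L :=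
    fun p a => ⟨off_nonneg hl0 a, off_add_le_sum hl0 a⟩
  refine ⟨(fun a => avg f r (off p a lam), fun a => avg f r (off p a lam + lam a - r)),
    fun a => ⟨hlarge _ ?_, norm_avg_le hfm hf1 hr _, hlarge _ ?_, norm_avg_le hfm hf1 hr _⟩,
    fun a b hab => ?_, fun a b hab => ?_, fun a b ha hb => ?_, fun a b ha hb => ?_⟩
  · exact ⟨(hoff p a).1, by linarith [(hoff p a).2, hrl a]⟩
  · exact ⟨by linarith [(hoff p a).1, hrl a], by linarith [(hoff p a).2]⟩
  · simp only
    rw [off_add_eq_off hab]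
    refine hadj _ (by linarith [(hoff p a).1, hrl a]) ?_
    rw [← off_add_eq_off (lam := lam) hab]
    linarith [(hoff p b).2, hrl b]
  · simp only
    rw [← hU, ← hU', off_add_eq_off hab]
    refine hadj _ (by linarith [(hoff q a).1, hrl a]) ?_
    rw [← off_add_eq_off (lam := lam) hab]
    linarith [(hoff q b).2, hrl b]
  · simp only
    rw [← hU, off_eq_zero ha, off_eq_zero hb, sub_self, norm_zero]
    exact hε.le
  · simp only
    rw [← hU', off_add_eq_sum ha, off_add_eq_sum hb, sub_self, norm_zero]
    exact hε.le

end limit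

section orbits

variable (π : Equiv.Perm (Fin m))

lemma piExtInv_piExt (i : ℕ) : piExtInv π (piExt π i) = i := by
  unfold piExt piExtInv
  split_ifs with h h'
  · simp only [add_tsub_cancel_right, Fin.eta, Equiv.symm_apply_apply]
    omega
  · have := (π ⟨i - 1, by omega⟩).2
    omega
  · rfl

lemma piExt_piExtInv (i : ℕ) : piExt π (piExtInv π i) = i := by
  unfold piExt piExtInv
  split_ifs with h h'
  · simp only [add_tsub_cancel_right, Fin.eta, Equiv.apply_symm_apply]
    omega
  · have := (π.symm ⟨i - 1, by omega⟩).2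
    omega
  · rfl

lemma piExt_le {i : ℕ} (h : i ≤ m) : piExt π i ≤ m := by
  unfold piExt
  split_ifs with h'
  · exact (π ⟨i - 1, by omega⟩).2
  · exact h

lemma piExtInv_bounds {i : ℕ} (h1 : 1 ≤ i) (h2 : i ≤ m + 1) :
    1 ≤ piExtInv π i ∧ piExtInv π i ≤ m + 1 := by
  unfold piExtInv
  split_ifs with h'
  · have := (π.symm ⟨i - 1, by omega⟩).2
    omega
  · exact ⟨h1, h2⟩

lemma sigmaPi_le {i : ℕ} (h : i ≤ m) : sigmaPi π i ≤ m := by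
  have := piExtInv_bounds π (i := piExt π i + 1) (by omega) (by have := piExt_le π h; omega)
  unfold sigmaPi
  omega

lemma sigmaPi_inj {i j : ℕ} (hi : i ≤ m) (hj : j ≤ m) (h : sigmaPi π i = sigmaPi π j) :
    i = j := by
  have h1 := piExtInv_bounds π (i := piExt π i + 1) (by omega) (by have := piExt_le π hi; omega)
  have h2 := piExtInv_bounds π (i := piExt π j + 1) (by omega) (by have := piExt_le π hj; omega)
  unfold sigmaPi at h
  have h3 : piExtInv π (piExt π i + 1) = piExtInv π (piExt π j + 1) := by omega
  have h4 := congrArg (piExt π) h3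
  rw [piExt_piExtInv, piExt_piExtInv] at h4
  have h5 : piExt π i = piExt π j := by omega
  have h6 := congrArg (piExtInv π) h5
  rwa [piExtInv_piExt, piExtInv_piExt] at h6

lemma sigmaPi_zero (hm : 0 < m) : sigmaPi π 0 = π.symm ⟨0, hm⟩ := by
  have : 1 ≤ m := hm
  simp [sigmaPi, piExt, piExtInv, this]

lemma sigmaPi_succ (a : Fin m) (h : (π a : ℕ) + 1 < m) :
    sigmaPi π (a + 1) = π.symm ⟨π a + 1, h⟩ := by
  have h1 : (a : ℕ) + 1 ≤ m := a.2
  have h2 : (π a : ℕ) + 1 + 1 ≤ m := h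
  simp [sigmaPi, piExt, piExtInv, h1, h2]

lemma sigmaPi_succ_last (a : Fin m) (h : (π a : ℕ) + 1 = m) : sigmaPi π (a + 1) = m := by
  have h1 : (a : ℕ) + 1 ≤ m := a.2
  simp [sigmaPi, piExt, piExtInv, h1, h]

lemma sigmaPi_iterate_le {i : ℕ} (h : i ≤ m) (n : ℕ) : (sigmaPi π)^[n] i ≤ m := by
  induction n with
  | zero => exact h
  | succ n ih => rw [Function.iterate_succ_apply']; exact sigmaPi_le π ih

lemma sigmaPi_mem_iff {S : Finset ℕ} (hS : S ∈ orbitsOf π) {i : ℕ} (hi : i ≤ m) :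
    sigmaPi π i ∈ S ↔ i ∈ S := by
  obtain ⟨i₀, hi₀, rfl⟩ := Finset.mem_image.1 hS
  rw [Finset.mem_Iic] at hi₀
  simp only [orbitOf, Finset.mem_filter, Finset.mem_Iic, sigmaPi_le π hi, hi, true_and]
  constructor
  · rintro ⟨k, hk⟩
    let s : Fin (m + 1) → Fin (m + 1) := fun j =>
      ⟨sigmaPi π j, Nat.lt_succ_of_le (sigmaPi_le π (Nat.le_of_lt_succ j.2))⟩
    have hs : Function.Injective s := fun j j' h =>
      Fin.ext (sigmaPi_inj π (Nat.le_of_lt_succ j.2) (Nat.le_of_lt_succ j'.2) (Fin.ext_iff.1 h))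
    have hit : ∀ n (j : Fin (m + 1)), ((s^[n] j : Fin (m + 1)) : ℕ) = (sigmaPi π)^[n] j := by
      intro n
      induction n with
      | zero => intro j; rfl
      | succ n ih => intro j; rw [Function.iterate_succ_apply, ih, Function.iterate_succ_apply]
    obtain ⟨n, hn, hper⟩ := hs.mem_periodicPts ⟨i₀, Nat.lt_succ_of_le hi₀⟩
    have hper' : (sigmaPi π)^[n] i₀ = i₀ := by
      have := hit n ⟨i₀, Nat.lt_succ_of_le hi₀⟩
      rw [hper.eq] at this
      exact this.symm
    refine ⟨k + (n - 1), sigmaPi_inj π (sigmaPi_iterate_le π hi₀ _) hi ?_⟩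
    rw [← Function.iterate_succ_apply' (sigmaPi π), ← hk, show (k + (n - 1)).succ = k + n by omega,
      Function.iterate_add_apply, hper']
  · rintro ⟨n, hn⟩
    exact ⟨n + 1, by rw [Function.iterate_succ_apply', hn]⟩

end orbits

section telescope

lemma prod_range_div_telescope {F : ℕ → ℂ} (hF : ∀ i, F i ≠ 0) (n : ℕ) :
    ∏ i ∈ Finset.range n, F i / F (i + 1) = F 0 / F n := by
  induction n with
  | zero => simp [hF]
  | succ n ih => rw [Finset.prod_range_succ, ih, div_mul_div_cancel₀ (hF n)]

/-- Exact matching conditions force the multiplier attached to each orbit to be trivial. -/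
lemma prod_zpow_bvec_eq_one {π : Equiv.Perm (Fin m)} {e : Fin m → ℂ} (he : ∀ a, e a ≠ 0)
    {U : (Fin m → ℂ) × (Fin m → ℂ)} (hU : Compat 1 π e 0 U) {S : Finset ℕ}
    (hS : S ∈ orbitsOf π) : ∏ a, e a ^ bvec S a = 1 := by
  rcases Nat.eq_zero_or_pos m with rfl | hm
  · simp
  have hlt : m - 1 < m := by omega
  obtain ⟨hn, hp, hq, h0, h1⟩ := hU
  simp only [norm_le_zero_iff, sub_eq_zero, Equiv.Perm.one_apply, sub_zero] at hn hp hq h0 h1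
  have hn1 : ∀ a, U.1 a ≠ 0 := fun a h => by have := (hn a).1; rw [h, norm_zero] at this; linarith
  have hn2 : ∀ a, U.2 a ≠ 0 := fun a h => by
    have := (hn a).2.2.1; rw [h, norm_zero] at this; linarith
  set c : ℕ → ℤ := fun i => if i ∈ S then 1 else 0 with hc
  have hcσ : ∀ i ≤ m, c (sigmaPi π i) = c i := fun i hi => by
    simp only [hc, sigmaPi_mem_iff π hS hi]
  set g : ℕ → ℂ := fun i => if h : i < m then U.1 ⟨i, h⟩ else U.2 ⟨m - 1, hlt⟩ with hg
  set k : ℕ → ℂ := fun i => if h : i < m then e (π.symm ⟨i, h⟩) * U.1 (π.symm ⟨i, h⟩)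
    else e (π.symm ⟨m - 1, hlt⟩) * U.2 (π.symm ⟨m - 1, hlt⟩) with hk
  set d : ℕ → ℤ := fun i => if h : i < m then c (π.symm ⟨i, h⟩) else c m with hd
  have hg0 : ∀ i, g i ≠ 0 := fun i => by
    simp only [hg]; split_ifs <;> simp [hn1, hn2]
  have hk0 : ∀ i, k i ≠ 0 := fun i => by
    simp only [hk]; split_ifs <;> simp [hn1, hn2, he]
  have hga : ∀ a : Fin m, g a = U.1 a := fun a => by simp [hg]
  have hga' : ∀ a : Fin m, g (a + 1) = U.2 a := fun a => by
    simp only [hg]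
    split_ifs with h
    · exact hp a ⟨a + 1, h⟩ rfl
    · exact congrArg U.2 (Fin.ext (show m - 1 = (a : ℕ) by have := a.2; omega))
  have hka : ∀ a : Fin m, k (π a) = e a * g a := fun a => by simp [hk, hga]
  have hka' : ∀ a : Fin m, k (π a + 1) = e a * g (a + 1) := fun a => by
    rw [hga']
    simp only [hk]
    split_ifs with h
    · exact hq a _ (by simp)
    · have h2 : π.symm ⟨m - 1, hlt⟩ = a := by
        rw [Equiv.symm_apply_eq]
        ext
        have := (π a).2
        simp only
        omega
      rw [h2]
  have hda : ∀ a : Fin m, d (π a) = c a := fun a => by simp [hd]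
  have hda' : ∀ a : Fin m, d (π a + 1) = c (a + 1) := fun a => by
    rw [← hcσ (a + 1) a.2]
    simp only [hd]
    split_ifs with h
    · rw [sigmaPi_succ π a h]
    · rw [sigmaPi_succ_last π a (by have := (π a).2; omega)]
  have hd0 : d 0 = c 0 := by
    rw [← hcσ 0 (Nat.zero_le _), sigmaPi_zero π hm]
    simp [hd, hm]
  have hdm : d m = c m := by simp [hd]
  have hgk0 : g 0 = k 0 := by
    simp only [hg, hk, hm, dif_pos]
    exact h0 _ _ rfl (by simp)
  have hgkm : g m = k m := by
    simp only [hg, hk, lt_irrefl, dif_neg, not_false_iff]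
    refine h1 _ _ ?_ ?_ <;> simp <;> omega
  have hterm : ∀ a : Fin m, e a ^ bvec S a =
      (k (π a) ^ d (π a) / k (π a + 1) ^ d (π a + 1)) /
        (g a ^ c a / g (a + 1) ^ c (a + 1)) := by
    intro a
    have hb : bvec S a = c a - c (a + 1) := rfl
    rw [hda, hda', hka, hka', hb, mul_zpow, mul_zpow, zpow_sub₀ (he a)]
    have := zpow_ne_zero (c a) (hg0 a)
    have := zpow_ne_zero (c (a + 1)) (hg0 (a + 1))
    have := zpow_ne_zero (c a) (he a)
    have := zpow_ne_zero (c (a + 1)) (he a)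
    field_simp
  have hK : ∀ i, k i ^ d i ≠ 0 := fun i => zpow_ne_zero _ (hk0 i)
  have hG : ∀ i, g i ^ c i ≠ 0 := fun i => zpow_ne_zero _ (hg0 i)
  rw [Finset.prod_congr rfl fun a _ => hterm a, Finset.prod_div_distrib,
    Equiv.prod_comp π fun b : Fin m => k b ^ d b / k (b + 1) ^ d (b + 1),
    Fin.prod_univ_eq_prod_range (fun i => k i ^ d i / k (i + 1) ^ d (i + 1)),
    Fin.prod_univ_eq_prod_range (fun i => g i ^ c i / g (i + 1) ^ c (i + 1)),
    prod_range_div_telescope hK, prod_range_div_telescope hG, hgk0, hgkm, hd0, hdm, div_self]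
  rw [← hgk0, ← hgkm]
  exact div_ne_zero (hG 0) (hG m)

end telescope

section irreducible

lemma sum_initial_lt {k : ℕ} {B : Finset (Fin m)}
    (hcard : B.card = (Finset.univ.filter fun i : Fin m => (i : ℕ) < k).card)
    (hne : B ≠ Finset.univ.filter fun i : Fin m => (i : ℕ) < k) :
    ∑ i ∈ Finset.univ.filter (fun i : Fin m => (i : ℕ) < k), (i : ℝ) < ∑ i ∈ B, (i : ℝ) := by
  set A := Finset.univ.filter fun i : Fin m => (i : ℕ) < k with hA
  have h1 := Finset.sum_inter_add_sum_sdiff A B fun i : Fin m => (i : ℝ)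
  have h2 := Finset.sum_inter_add_sum_sdiff B A fun i : Fin m => (i : ℝ)
  rw [Finset.inter_comm] at h2
  have hc : (A \ B).card = (B \ A).card := by
    have h3 := Finset.card_sdiff_add_card_inter A B
    have h4 := Finset.card_sdiff_add_card_inter B A
    rw [Finset.inter_comm] at h4
    omega
  have hpos : 0 < (A \ B).card := by
    rw [Finset.card_pos, Finset.sdiff_nonempty]
    exact fun hsub => hne (Finset.eq_of_subset_of_card_le hsub hcard.le).symm
  have h5 : ∑ i ∈ A \ B, (i : ℝ) ≤ (A \ B).card • ((k : ℝ) - 1) := by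
    refine Finset.sum_le_card_nsmul _ _ _ fun i hi => ?_
    have h6 : (i : ℕ) + 1 ≤ k := by simpa [hA] using (Finset.mem_sdiff.1 hi).1
    have h7 : ((i : ℕ) : ℝ) + 1 ≤ k := by exact_mod_cast h6
    linarith
  have h8 : (B \ A).card • (k : ℝ) ≤ ∑ i ∈ B \ A, (i : ℝ) := by
    refine Finset.card_nsmul_le_sum _ _ _ fun i hi => ?_
    have h6 : k ≤ (i : ℕ) := by simpa [hA] using (Finset.mem_sdiff.1 hi).2
    exact_mod_cast h6
  rw [← hc] at h8
  rw [nsmul_eq_mul] at h5 h8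
  have h9 : (0 : ℝ) < (A \ B).card := by exact_mod_cast hpos
  linarith

/-- An irreducible permutation admits suspension data. -/
lemma suspended_of_irreducible {π : Equiv.Perm (Fin m)} (hirr : PermIrreducible π)
    (hm : 2 ≤ m) : Suspended 1 π fun a => ((π a : ℕ) : ℝ) - (a : ℕ) where
  top_pos a ha := by
    have ha' : (a : ℕ) ≠ 0 := ha
    rw [off_apply, Finset.sum_sub_distrib, sub_pos]
    have h1 := hirr a (by omega) a.2.le
    have h2 : Finset.univ.filter (fun b => (1 : Equiv.Perm (Fin m)) b < (1 : Equiv.Perm (Fin m)) a)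
        = Finset.univ.filter fun i : Fin m => (i : ℕ) < a := by
      ext b
      simp only [Finset.mem_filter, Finset.mem_univ, true_and]
      rfl
    rw [h2]
    have h3 := sum_initial_lt (k := a)
      (Finset.card_image_of_injective (Finset.univ.filter fun i : Fin m => (i : ℕ) < a) π.injective)
      fun h => a.2.ne (h1 h)
    rwa [Finset.sum_image π.injective.injOn] at h3
  bot_neg a ha := by
    rw [off_apply, Finset.sum_sub_distrib, sub_neg]
    have h1 := hirr (π a) (by omega) (π a).2.le
    set B := Finset.univ.filter fun b => π b < π a with hB
    have h2 : B.image π = Finset.univ.filter fun i : Fin m => (i : ℕ) < π a := by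
      ext b
      simp only [hB, Finset.mem_image, Finset.mem_filter, Finset.mem_univ, true_and]
      exact ⟨fun ⟨c, hc, hcb⟩ => hcb ▸ hc, fun hb => ⟨π.symm b, by simpa using hb, by simp⟩⟩
    have h3 : ∑ b ∈ B, ((π b : ℕ) : ℝ) =
        ∑ i ∈ Finset.univ.filter (fun i : Fin m => (i : ℕ) < π a), (i : ℝ) := by
      rw [← h2, Finset.sum_image π.injective.injOn]
    rw [h3]
    refine sum_initial_lt ?_ fun h => ?_
    · rw [← h2, Finset.card_image_of_injective _ π.injective]
    · exact (π a).2.ne (h1 (h ▸ h2))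
  ne_or_ne a := by
    by_contra! hcon
    obtain ⟨h0, h1⟩ := hcon
    have ha : (a : ℕ) = 0 := h0
    refine (show 1 ≠ m by omega) (hirr 1 le_rfl (by omega) ?_)
    have h2 : Finset.univ.filter (fun i : Fin m => (i : ℕ) < 1) = {a} := by
      ext b
      simp [Fin.ext_iff, ha]
    rw [h2, Finset.image_singleton, Finset.singleton_inj]
    ext
    rw [h1, ha]

end irreducible

section translation

variable {lam : Fin m → ℝ} {π : Equiv.Perm (Fin m)}

lemma off_one_eq_pre (j : Fin m) : off 1 j lam = pre lam j := by
  rw [off_apply, pre]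
  rfl

lemma blk_one_eq_block (j : Fin m) : blk 1 lam j = block lam j := by
  rw [blk, block, off_one_eq_pre]

lemma wv_one_eq_wvec (j : Fin m) : wv 1 π j lam = wvec lam π j := by
  rw [wv, LinearMap.sub_apply, off_one_eq_pre, off_apply, wvec]

lemma trans_one_eq_iet : trans 1 π lam = iet lam π := by
  funext x
  simp only [trans, iet, blk_one_eq_block, wv_one_eq_wvec]

lemma phiFn_of_mem (hl : ∀ a, 0 ≤ lam a) {nu : Fin m → ℝ} {a : Fin m} {x : ℝ}
    (hx : x ∈ blk 1 lam a) :
    phiFn lam nu x = Complex.exp (2 * Real.pi * Complex.I * (nu a : ℂ)) := by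
  rw [phiFn, Finset.prod_eq_single a]
  · rw [if_pos (by rwa [← blk_one_eq_block])]
  · intro b _ hb
    rw [if_neg fun h => hb (blk_unique hl (by rwa [blk_one_eq_block]) hx)]
  · exact fun h => absurd (Finset.mem_univ a) h

lemma norm_exp_two_pi_I (x : ℝ) : ‖Complex.exp (2 * Real.pi * Complex.I * (x : ℂ))‖ = 1 := by
  rw [show 2 * Real.pi * Complex.I * (x : ℂ) = ((2 * Real.pi * x : ℝ) : ℂ) * Complex.I by
    push_cast; ring]
  exact Complex.norm_exp_ofReal_mul_I _

/-- If the twisted equation is solvable then `b_S · ν` is an integer for each orbit `S`. -/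
lemma exists_int_of_solution (hl : ∀ a, 0 < lam a) (hg : Generic 1 π lam) {s : ℝ} (hs : 0 < s)
    (hgood : ∃ᶠ n : ℕ in Filter.atTop, Good π 1 n (s / n) lam) {nu : Fin m → ℝ} {f : ℝ → ℂ}
    (hfm : Measurable f) (hpos : 0 < volume {x ∈ Ico (0 : ℝ) (∑ i, lam i) | f x ≠ 0})
    (hf : ∀ᵐ x ∂(volume : Measure ℝ), x ∈ Ico (0 : ℝ) (∑ i, lam i) →
      f (iet lam π x) = phiFn lam nu x * f x) {S : Finset ℕ} (hS : S ∈ orbitsOf π) :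
    ∃ n : ℤ, ∑ i, (bvec S i : ℝ) * nu i = n := by
  have hl0 : ∀ a, 0 ≤ lam a := fun a => (hl a).le
  set L := ∑ i, lam i with hL
  set e : Fin m → ℂ := fun a => Complex.exp (2 * Real.pi * Complex.I * (nu a : ℂ)) with he
  have he1 : ∀ a, ‖e a‖ = 1 := fun a => norm_exp_two_pi_I _
  set F : ℝ → ℂ := (Ico (0 : ℝ) L).indicator fun x => f x / ‖f x‖ with hF
  have hFm : Measurable F :=
    (hfm.div (Complex.measurable_ofReal.comp hfm.norm)).indicator measurableSet_Ico
  have hF01 : ∀ z, ‖F z‖ = 0 ∨ ‖F z‖ = 1 := by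
    intro z
    by_cases hz : z ∈ Ico (0 : ℝ) L
    · rw [hF, indicator_of_mem hz, norm_div, Complex.norm_real, norm_norm]
      by_cases h : ‖f z‖ = 0
      · left; simp [h]
      · right; exact div_self h
    · left; rw [hF, indicator_of_notMem hz, norm_zero]
  have hFi : Integrable F := by
    have h1 : Integrable ((Ico (0 : ℝ) L).indicator fun _ => (1 : ℝ)) :=
      (integrable_indicator_iff measurableSet_Ico).2 (integrableOn_const (by simp))
    refine h1.mono hFm.aestronglyMeasurable (Filter.Eventually.of_forall fun z => ?_)
    by_cases hz : z ∈ Ico (0 : ℝ) L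
    · rw [indicator_of_mem hz, norm_one]
      rcases hF01 z with h | h <;> simp [h]
    · rw [hF, indicator_of_notMem hz, indicator_of_notMem hz, norm_zero, norm_zero]
  have hFpos : 0 < volume {x ∈ Ico (0 : ℝ) L | F x ≠ 0} := by
    refine hpos.trans_le (measure_mono fun x hx => ⟨hx.1, ?_⟩)
    rw [hF, indicator_of_mem hx.1]
    exact div_ne_zero hx.2 (by simpa using hx.2)
  have hFs : Solves 1 π lam e F := by
    intro a
    filter_upwards [hf] with x hx hxa
    have h1 := blk_subset hl0 a hxa
    have h2 := blk_subset hl0 a (trans_mem_blk (q := π) hl0 hxa)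
    have h3 := hx h1
    rw [phiFn_of_mem hl0 hxa, ← trans_one_eq_iet, trans_of_mem hl0 hxa] at h3
    rw [trans_of_mem hl0 hxa] at h2
    have h4 : f (x + wv 1 π a lam) = e a * f x := h3
    rw [hF, indicator_of_mem h2, indicator_of_mem h1, h4, norm_mul, he1, one_mul, mul_div_assoc]
  obtain ⟨U, hU⟩ := exists_compat_zero fun ε hε =>
    exists_compat hFm hF01 hFi hFpos hFs he1 hl hg hs hgood hε
  have hprod := prod_zpow_bvec_eq_one (fun a => Complex.exp_ne_zero _) hU hS
  have h5 : Complex.exp (∑ a, (bvec S a : ℂ) * (2 * Real.pi * Complex.I * (nu a : ℂ))) = 1 := by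
    rw [Complex.exp_sum, ← hprod]
    exact Finset.prod_congr rfl fun a _ => Complex.exp_int_mul _ _
  obtain ⟨n, hn⟩ := Complex.exp_eq_one_iff.1 h5
  refine ⟨n, ?_⟩
  have h6 : ∑ a, (bvec S a : ℂ) * (2 * Real.pi * Complex.I * (nu a : ℂ)) =
      (∑ a, (bvec S a : ℂ) * (nu a : ℂ)) * (2 * Real.pi * Complex.I) := by
    rw [Finset.sum_mul]
    exact Finset.sum_congr rfl fun a _ => by ring
  rw [h6] at hn
  have h7 := mul_right_cancel₀ Complex.two_pi_I_ne_zero hn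
  exact_mod_cast h7

end translation

end IET

/-- for irreducible `π` and Lebesgue-a.e. `λ ∈ ℝ₊^m`, for every positive
vector `t ∈ ℝ^m`: if there are orbits `S_j, S_k ∈ Σ(π)` such that the reals `b_{S_j}·t`
and `b_{S_k}·t` are linearly independent over the integers, then for every real `α ≠ 0`
the equation `f(T_{(λ,π)}x) = exp(2πi α t_j) f(x)` for `x ∈ I_j^λ` (a.e. on `[0,|λ|)`)
admits no measurable solution that is nonzero on a set of positive Lebesgue measure. -/
theorem stmt8 (m : ℕ) (hm : 1 ≤ m) (π : Equiv.Perm (Fin m))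
    (hirr : PermIrreducible π) :
    ∀ᵐ lam ∂(volume : Measure (Fin m → ℝ)), (∀ j, 0 < lam j) →
      ∀ t : Fin m → ℝ, (∀ j, 0 < t j) →
        (∃ Sj ∈ orbitsOf π, ∃ Sk ∈ orbitsOf π,
          ∀ n₁ n₂ : ℤ,
            (n₁ : ℝ) * (∑ i : Fin m, (bvec Sj i : ℝ) * t i) +
              (n₂ : ℝ) * (∑ i : Fin m, (bvec Sk i : ℝ) * t i) = 0 →
            n₁ = 0 ∧ n₂ = 0) →
        ∀ α : ℝ, α ≠ 0 →
          ¬ ∃ f : ℝ → ℂ, Measurable f ∧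
              0 < volume {x ∈ Set.Ico (0 : ℝ) (∑ i, lam i) | f x ≠ 0} ∧
              ∀ᵐ x ∂(volume : Measure ℝ), x ∈ Set.Ico (0 : ℝ) (∑ i, lam i) →
                f (iet lam π x) = phiFn lam (fun j => α * t j) x * f x := by
  have hcontra : ∀ (t : Fin m → ℝ) (Sj Sk : Finset ℕ),
      (∀ n₁ n₂ : ℤ, (n₁ : ℝ) * (∑ i : Fin m, (bvec Sj i : ℝ) * t i) +
        (n₂ : ℝ) * (∑ i : Fin m, (bvec Sk i : ℝ) * t i) = 0 → n₁ = 0 ∧ n₂ = 0) →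
      ∀ (α : ℝ) (k l : ℤ), α ≠ 0 → α * (∑ i : Fin m, (bvec Sj i : ℝ) * t i) = k →
        α * (∑ i : Fin m, (bvec Sk i : ℝ) * t i) = l → False := by
    intro t Sj Sk hind α k l hα hk hl
    set x := ∑ i : Fin m, (bvec Sj i : ℝ) * t i
    set y := ∑ i : Fin m, (bvec Sk i : ℝ) * t i
    have h1 : ((l : ℤ) : ℝ) * x + ((-k : ℤ) : ℝ) * y = 0 := by
      push_cast
      rw [← hk, ← hl]
      ring
    have hk0 : k = 0 := by have := (hind l (-k) h1).2; omega
    rw [hk0, Int.cast_zero, mul_eq_zero] at hk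
    have h2 := hind 1 0 (by rw [hk.resolve_left hα]; simp)
    exact one_ne_zero h2.1
  rcases Nat.lt_or_ge 1 m with hm2 | hm1
  · have hsus := IET.suspended_of_irreducible hirr hm2
    filter_upwards [hsus.ae_generic, hsus.swap.ae_frequently_good hm] with lam hgen hgood hlam t ht
    rintro ⟨Sj, hSj, Sk, hSk, hind⟩ α hα ⟨f, hfm, hpos, hf⟩
    obtain ⟨s, hs, hgood⟩ := hgood hlam
    have key : ∀ S ∈ orbitsOf π, ∃ n : ℤ, α * ∑ i, (bvec S i : ℝ) * t i = n := by
      intro S hS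
      obtain ⟨n, hn⟩ := IET.exists_int_of_solution hlam hgen hs hgood hfm hpos hf hS
      refine ⟨n, hn ▸ ?_⟩
      rw [Finset.mul_sum]
      exact Finset.sum_congr rfl fun i _ => by ring
    obtain ⟨k, hk⟩ := key Sj hSj
    obtain ⟨l, hl⟩ := key Sk hSk
    exact hcontra t Sj Sk hind α k l hα hk hl
  · obtain rfl : m = 1 := le_antisymm hm1 hm
    refine Filter.Eventually.of_forall fun lam _ t ht => ?_
    rintro ⟨Sj, -, Sk, -, hind⟩ α - -
    have ht0 := (ht 0).ne'
    refine hcontra t Sj Sk hind (t 0)⁻¹ (bvec Sj (0 : Fin 1)) (bvec Sk (0 : Fin 1))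
      (inv_ne_zero ht0) ?_ ?_ <;>
    · rw [Fin.sum_univ_one]
      field_simp
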